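/- Slipknots are well-bracketed: if p ⇒m q is a parallel multiplicative reduction of acyclic MLL proof nets, there is no path in q of the form (d₁)χ₁(d₂)χ₂(d′₁)χ₃(d′₂) such that, for i = 1,2, dᵢ and d′ᵢ are residual cut edges of the same eliminated cut of p. -/

import Mathlib

/- Formalization of untyped MLL proof nets with jumps, switching paths,
   and parallel cut elimination, following Chouquet & Vaux Auclair. -/

namespace MLLNets

attribute [local instance] Classical.propDecidable

/-- Trees of MLL nets: variables (axiom conclusions, paired by the involution
    `(n,b) ↦ (n,!b)`), labelled units `1_λ`, labelled counits `⊥_μ`, and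
    n-ary connectives `⊗`, `⅋`. -/
inductive Tree : Type where
  | var : ℕ → Bool → Tree
  | unit : ℕ → Tree
  | counit : ℕ → Tree
  | tens : List Tree → Tree
  | parr : List Tree → Tree

instance : Inhabited Tree := ⟨Tree.unit 0⟩

/-- Atoms: variables, unit labels, counit labels. -/
inductive Atom : Type where
  | var : ℕ → Bool → Atom
  | unit : ℕ → Atom
  | counit : ℕ → Atom

namespace Tree

/-- Number of subtrees of a tree. -/
def size : Tree → ℕ
  | var _ _ => 1
  | unit _ => 1
  | counit _ => 1
  | tens ts => 1 + (ts.attach.map (fun x => x.1.size)).sum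
  | parr ts => 1 + (ts.attach.map (fun x => x.1.size)).sum
termination_by t => sizeOf t
decreasing_by all_goals (have h := List.sizeOf_lt_of_mem x.2; simp; omega)

/-- The set of subtrees of a tree. -/
noncomputable def ST : Tree → Finset Tree
  | var n b => {var n b}
  | unit l => {unit l}
  | counit l => {counit l}
  | tens ts => insert (tens ts) ((ts.attach.map (fun x => x.1.ST)).foldr (· ∪ ·) ∅)
  | parr ts => insert (parr ts) ((ts.attach.map (fun x => x.1.ST)).foldr (· ∪ ·) ∅)
termination_by t => sizeOf t
decreasing_by all_goals (have h := List.sizeOf_lt_of_mem x.2; simp; omega)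

/-- The multiset of atoms occurring in a tree. -/
def atoms : Tree → Multiset Atom
  | var n b => {Atom.var n b}
  | unit l => {Atom.unit l}
  | counit l => {Atom.counit l}
  | tens ts => (ts.attach.map (fun x => x.1.atoms)).sum
  | parr ts => (ts.attach.map (fun x => x.1.atoms)).sum
termination_by t => sizeOf t
decreasing_by all_goals (have h := List.sizeOf_lt_of_mem x.2; simp; omega)

/-- Substitution of the tree `s` for the variable `(n, b)`. -/
def subst (n : ℕ) (b : Bool) (s : Tree) : Tree → Tree
  | var m c => if m = n ∧ c = b then s else var m c
  | unit l => unit l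
  | counit l => counit l
  | tens ts => tens (ts.attach.map (fun x => Tree.subst n b s x.1))
  | parr ts => parr (ts.attach.map (fun x => Tree.subst n b s x.1))
termination_by t => sizeOf t
decreasing_by all_goals (have h := List.sizeOf_lt_of_mem x.2; simp; omega)

/-- Iterated substitution `t[t₁/x̄₁]⋯[tₙ/x̄ₙ]`: each list entry `((n,b), s)`
    records an axiom cut `⟨x|s⟩` with `x = (n,b)`, and `s` is substituted
    for `x̄ = (n, !b)`. -/
def substList (l : List ((ℕ × Bool) × Tree)) (t : Tree) : Tree :=
  l.foldl (fun u e => u.subst e.1.1 (!e.1.2) e.2) t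

end Tree

/-- A (bare) proof net with a jump function: a finite set of cuts, a finite
    family of conclusion trees, and a jump function assigning a tree to each
    counit label. -/
structure Net : Type where
  cuts : Finset (Tree × Tree)
  concl : List Tree
  jump : ℕ → Tree

namespace Net

/-- The subtrees of a net. -/
noncomputable def ST (p : Net) : Finset Tree :=
  (p.cuts.biUnion fun c => c.1.ST ∪ c.2.ST) ∪ (p.concl.map Tree.ST).foldr (· ∪ ·) ∅

/-- The multiset of atoms of a net. -/
def atoms (p : Net) : Multiset Atom :=
  (p.cuts.val.map fun c => c.1.atoms + c.2.atoms).sum + (p.concl.map Tree.atoms).sum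

/-- The counit labels occurring in a net. -/
noncomputable def counitLabels (p : Net) : Finset ℕ :=
  p.ST.biUnion fun t => match t with | Tree.counit l => {l} | _ => ∅

/-- The size of a net: its number of subtrees. -/
def size (p : Net) : ℕ :=
  (p.cuts.sum fun c => c.1.size + c.2.size) + (p.concl.map Tree.size).sum

/-- Well-formedness: each atom occurs at most once, connectives have arity
    ≥ 1, variables are closed under the involution, and jumps of counits
    occurring in the net are subtrees of the net. -/
def IsMLL (p : Net) : Prop :=
  p.atoms.Nodup ∧
  (∀ ts, Tree.tens ts ∈ p.ST → ts ≠ []) ∧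
  (∀ ts, Tree.parr ts ∈ p.ST → ts ≠ []) ∧
  (∀ n b, Atom.var n b ∈ p.atoms → Atom.var n (!b) ∈ p.atoms) ∧
  (∀ m, Tree.counit m ∈ p.ST → p.jump m ∈ p.ST)

end Net

/-- Edges of switching graphs: axiom edges, ⊗-edges (one per premise),
    ⅋-edges (one per ⅋-tree, its other endpoint chosen by the switching),
    jump edges and cut edges. -/
inductive Edge : Type where
  | ax : ℕ → Edge
  | tensE : Tree → Tree → Edge
  | parrE : Tree → Edge
  | jumpE : ℕ → Edge
  | cutE : Tree → Tree → Edge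

/-- A switching chooses a premise of each ⅋-subtree. -/
def Net.IsSwitching (p : Net) (I : Tree → Tree) : Prop :=
  ∀ ts, Tree.parr ts ∈ p.ST → I (Tree.parr ts) ∈ ts

/-- Adjacency in the switching graph of `p` determined by the switching `I`. -/
inductive Net.Adj (p : Net) (I : Tree → Tree) : Edge → Tree → Tree → Prop
  | ax (n : ℕ) : Tree.var n true ∈ p.ST → Tree.var n false ∈ p.ST →
      Net.Adj p I (Edge.ax n) (Tree.var n true) (Tree.var n false)
  | tens {ts t} : Tree.tens ts ∈ p.ST → t ∈ ts →
      Net.Adj p I (Edge.tensE (Tree.tens ts) t) (Tree.tens ts) t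
  | parr {ts} : Tree.parr ts ∈ p.ST →
      Net.Adj p I (Edge.parrE (Tree.parr ts)) (Tree.parr ts) (I (Tree.parr ts))
  | jump {m} : Tree.counit m ∈ p.ST →
      Net.Adj p I (Edge.jumpE m) (Tree.counit m) (p.jump m)
  | cut {t s} : (t, s) ∈ p.cuts → Net.Adj p I (Edge.cutE t s) t s
  | symm {e t u} : Net.Adj p I e t u → Net.Adj p I e u t

/-- `IsTrail p I t l` : `l` is a switching path (a sequence of pairwise
    distinct consecutive edges, each paired with the vertex it reaches)
    starting from the subtree `t`. -/
inductive Net.IsTrail (p : Net) (I : Tree → Tree) : Tree → List (Edge × Tree) → Prop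
  | nil (t) : t ∈ p.ST → Net.IsTrail p I t []
  | cons {t e u l} : Net.Adj p I e t u → Net.IsTrail p I u l → (∀ x ∈ l, x.1 ≠ e) →
      Net.IsTrail p I t ((e, u) :: l)

/-- `ln p` : the maximal length of a switching path of `p`. -/
noncomputable def Net.ln (p : Net) : ℕ :=
  sSup {n | ∃ I t l, p.IsSwitching I ∧ p.IsTrail I t l ∧ l.length = n}

/-- `jd p` : the maximal number of counit labels jumping to a common
    subtree of `p`. -/
noncomputable def Net.jd (p : Net) : ℕ :=
  p.ST.sup fun t => (p.counitLabels.filter fun m => p.jump m = t).card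

/-- A net is acyclic when no switching path visits the same subtree twice. -/
def Net.IsAcyclic (p : Net) : Prop :=
  ∀ I, p.IsSwitching I → ∀ t l, p.IsTrail I t l → (t :: l.map Prod.snd).Nodup

/-! ### Parallel cut elimination -/

/-- Cuts of `p` eliminated by the multiplicative family `F` (given by the
    lists of premises of the ⊗- and ⅋-trees of each cut). -/
noncomputable def melim (F : Finset (List Tree × List Tree)) : Finset (Tree × Tree) :=
  F.biUnion fun c => {(Tree.tens c.1, Tree.parr c.2), (Tree.parr c.2, Tree.tens c.1)}

/-- Residual cuts produced by the multiplicative family `F`. -/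
noncomputable def mres (F : Finset (List Tree × List Tree)) : Finset (Tree × Tree) :=
  F.biUnion fun c => (c.1.zip c.2).toFinset

/-- Cuts of `p` eliminated by an axiom family. -/
noncomputable def aelim (la : List ((ℕ × Bool) × Tree)) : Finset (Tree × Tree) :=
  la.foldr (fun e s =>
    insert (Tree.var e.1.1 e.1.2, e.2) (insert (e.2, Tree.var e.1.1 e.1.2) s)) ∅

/-- Cuts of `p` eliminated by an evanescent family (pairs `(λ, μ)` of a unit
    and a counit label). -/
noncomputable def eelim (le : List (ℕ × ℕ)) : Finset (Tree × Tree) :=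
  le.foldr (fun e s =>
    insert (Tree.unit e.1, Tree.counit e.2) (insert (Tree.counit e.2, Tree.unit e.1) s)) ∅

/-- The redirection function `ρ` for the parallel elimination of evanescent
    cuts: `Rho p le j t` holds when the jump of the `j`-th eliminated
    counit, followed along the chain of eliminated evanescent cuts, ends
    at the tree `t`. -/
inductive Rho (p : Net) (le : List (ℕ × ℕ)) : ℕ → Tree → Prop
  | base (j : ℕ) :
      (∀ i < j, p.jump ((le.getD j (0,0)).2) ≠ Tree.counit ((le.getD i (0,0)).2) ∧
                p.jump ((le.getD j (0,0)).2) ≠ Tree.unit ((le.getD i (0,0)).1)) →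
      Rho p le j (p.jump ((le.getD j (0,0)).2))
  | step {i j : ℕ} {t : Tree} : i < j →
      (p.jump ((le.getD j (0,0)).2) = Tree.counit ((le.getD i (0,0)).2) ∨
       p.jump ((le.getD j (0,0)).2) = Tree.unit ((le.getD i (0,0)).1)) →
      Rho p le i t → Rho p le j t

/-- `ParStepF p q F la le` : `q` is obtained from `p` by the simultaneous
    elimination of the family `F` of multiplicative cuts, the family `la` of
    axiom cuts and the family `le` of evanescent cuts. -/
structure ParStepF (p q : Net) (F : Finset (List Tree × List Tree))
    (la : List ((ℕ × Bool) × Tree)) (le : List (ℕ × ℕ)) : Prop where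
  /-- each member of `F` is a multiplicative cut of `p` -/
  hF : ∀ c ∈ F, c.1.length = c.2.length ∧ c.1 ≠ [] ∧
       ((Tree.tens c.1, Tree.parr c.2) ∈ p.cuts ∨ (Tree.parr c.2, Tree.tens c.1) ∈ p.cuts)
  /-- each member of `la` is an axiom cut of `p` -/
  ha : ∀ e ∈ la, (Tree.var e.1.1 e.1.2, e.2) ∈ p.cuts ∨ (e.2, Tree.var e.1.1 e.1.2) ∈ p.cuts
  haN : (la.map Prod.fst).Nodup
  /-- `x̄ᵢ ∉ {x₁, …, xₙ}` -/
  haBar : ∀ e ∈ la, (e.1.1, !e.1.2) ∉ la.map Prod.fst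
  /-- `x̄ᵢ` does not occur in `tⱼ` for `i ≤ j` -/
  haFv : ∀ i j, i ≤ j → j < la.length →
      Atom.var (la.getD i default).1.1 (!(la.getD i default).1.2) ∉ (la.getD j default).2.atoms
  /-- each member of `le` is a cut of `p` between a unit and a counit -/
  he : ∀ e ∈ le, (Tree.unit e.1, Tree.counit e.2) ∈ p.cuts ∨ (Tree.counit e.2, Tree.unit e.1) ∈ p.cuts
  heN : (le.map Prod.snd).Nodup
  /-- `jump(μᵢ) ∉ {⊥_{μⱼ}, 1_{λⱼ}}` for `i ≤ j` (in particular each eliminated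
      evanescent cut is reducible) -/
  heJ : ∀ i j, i ≤ j → j < le.length →
      p.jump ((le.getD i (0,0)).2) ≠ Tree.counit ((le.getD j (0,0)).2) ∧
      p.jump ((le.getD i (0,0)).2) ≠ Tree.unit ((le.getD j (0,0)).1)
  /-- the cuts of `q`: the remaining cuts plus the multiplicative residuals,
      under the substitution generated by the axiom cuts -/
  hcuts : q.cuts = ((p.cuts \ (melim F ∪ aelim la ∪ eelim le)) ∪ mres F).image
      (fun c => (Tree.substList la c.1, Tree.substList la c.2))
  /-- the conclusions of `q` -/
  hconcl : q.concl = p.concl.map (Tree.substList la)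
  /-- the jump function of `q`, with redirections -/
  hjump : ∀ m, Tree.counit m ∈ q.ST →
      (∃ c ∈ F, p.jump m = Tree.tens c.1 ∧ q.jump m = Tree.substList la c.1.headI) ∨
      (∃ c ∈ F, p.jump m = Tree.parr c.2 ∧ q.jump m = Tree.substList la c.2.headI) ∨
      (∃ i < la.length,
        (p.jump m = Tree.var (la.getD i default).1.1 (la.getD i default).1.2 ∨
         p.jump m = Tree.var (la.getD i default).1.1 (!(la.getD i default).1.2)) ∧
        q.jump m = Tree.substList (la.drop (i+1)) (la.getD i default).2) ∨
      (∃ i < le.length,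
        (p.jump m = Tree.counit ((le.getD i (0,0)).2) ∨
         p.jump m = Tree.unit ((le.getD i (0,0)).1)) ∧
        ∃ t, Rho p le i t ∧ q.jump m = Tree.substList la t) ∨
      ((∀ c ∈ F, p.jump m ≠ Tree.tens c.1 ∧ p.jump m ≠ Tree.parr c.2) ∧
       (∀ e ∈ la, p.jump m ≠ Tree.var e.1.1 e.1.2 ∧ p.jump m ≠ Tree.var e.1.1 (!e.1.2)) ∧
       (∀ e ∈ le, p.jump m ≠ Tree.counit e.2 ∧ p.jump m ≠ Tree.unit e.1) ∧
       q.jump m = Tree.substList la (p.jump m))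

/-- Parallel elimination of a family of multiplicative cuts (`p ⇒m q`). -/
def MultStep (p q : Net) : Prop := ∃ F, ParStepF p q F [] []

/-- Parallel elimination of a family of axiom cuts (`p ⇒a q`). -/
def AxStep (p q : Net) : Prop := ∃ la, ParStepF p q ∅ la []

/-- Parallel elimination of a family of evanescent cuts (`p ⇒e q`). -/
def EvStep (p q : Net) : Prop := ∃ le, ParStepF p q ∅ [] le

/-- A parallel cut elimination step (`p ⇒ q`), eliminating an arbitrary
    family of reducible cuts of the three kinds. -/
def ParStep (p q : Net) : Prop := ∃ F la le, ParStepF p q F la le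

/-- Elimination of a single reducible cut. -/
def Step1 (p q : Net) : Prop :=
  (∃ c, ParStepF p q {c} [] []) ∨ (∃ e, ParStepF p q ∅ [e] []) ∨ (∃ e, ParStepF p q ∅ [] [e])

/-- `k` parallel cut elimination steps. -/
def ParStepN : ℕ → Net → Net → Prop
  | 0, p, q => p = q
  | k+1, p, q => ∃ r, ParStep p r ∧ ParStepN k r q

/-! ### Evanescent cuts and the sets `Iⁿ(t)` -/

/-- `p.IsEvCut l m` : `⟨1_l | ⊥_m⟩` is a reducible evanescent cut of `p`. -/
def Net.IsEvCut (p : Net) (l m : ℕ) : Prop :=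
  ((Tree.unit l, Tree.counit m) ∈ p.cuts ∨ (Tree.counit m, Tree.unit l) ∈ p.cuts) ∧
  p.jump m ≠ Tree.unit l ∧ p.jump m ≠ Tree.counit m

/-- The sets `Iⁿ(t)` of counit labels reaching `t` through a chain of `n`
    evanescent cuts. -/
noncomputable def Net.Iset (p : Net) (t : Tree) : ℕ → Finset ℕ
  | 0 => p.counitLabels.filter fun m => p.jump m = t
  | n+1 => p.counitLabels.filter fun m' =>
      ∃ l m, p.IsEvCut l m ∧ m ∈ p.Iset t n ∧
        (p.jump m' = Tree.counit m ∨ p.jump m' = Tree.unit l)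

/-- The number of evanescent cuts of `p`. -/
noncomputable def Net.evCutCount (p : Net) : ℕ :=
  (p.cuts.filter fun c => ∃ l m,
    (c = (Tree.unit l, Tree.counit m) ∨ c = (Tree.counit m, Tree.unit l)) ∧
    p.jump m ≠ Tree.unit l ∧ p.jump m ≠ Tree.counit m).card

/-! ### The function φ -/

/-- `φ(0) = 0` and `φ(n) = n + (n+1)(φ(n-1)+2)` for `n > 0`. -/
def phi : ℕ → ℕ
  | 0 => 0
  | n + 1 => (n + 1) + (n + 2) * (phi n + 2)

/-! ### Residual edges, slipknots, bridges and bounces -/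

/-- The residual cut edges in `q` of an eliminated multiplicative cut. -/
noncomputable def resEdges (c : List Tree × List Tree) : Finset Edge :=
  ((c.1.zip c.2).map fun d => Edge.cutE d.1 d.2).toFinset

/-- Canonical form of a `c`-bridge: a path bound to `c` crossing its cut edge. -/
def IsBridgeCan (c : List Tree × List Tree) (b : List Edge) : Prop :=
  ∃ pre post : List Edge,
    (pre = [] ∨ ∃ t ∈ c.1, pre = [Edge.tensE (Tree.tens c.1) t]) ∧
    (post = [] ∨ post = [Edge.parrE (Tree.parr c.2)]) ∧
    (b = pre ++ Edge.cutE (Tree.tens c.1) (Tree.parr c.2) :: post ∨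
     b = pre ++ Edge.cutE (Tree.parr c.2) (Tree.tens c.1) :: post)

/-- A `c`-bridge, in either direction. -/
def IsBridge (c : List Tree × List Tree) (b : List Edge) : Prop :=
  IsBridgeCan c b ∨ IsBridgeCan c b.reverse

/-- A `c`-bounce: a path bound to `c`, not crossing its cut edge, and
    visiting its ⊗-tree. -/
def IsBounce (c : List Tree × List Tree) (b : List Edge) : Prop :=
  b = [] ∨ (∃ t ∈ c.1, b = [Edge.tensE (Tree.tens c.1) t]) ∨
  (∃ t ∈ c.1, ∃ t' ∈ c.1, t ≠ t' ∧
    b = [Edge.tensE (Tree.tens c.1) t, Edge.tensE (Tree.tens c.1) t'])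

/-- `Gen F es es'` : the edge sequence `es'` (in `p`) is generated by the
    straight edge sequence `es` (in `q`): preserved edges are kept, and each
    residual cut edge is replaced by a bridge of the corresponding
    eliminated cut. -/
inductive Gen (F : Finset (List Tree × List Tree)) : List Edge → List Edge → Prop
  | nil : Gen F [] []
  | pres {e l l'} : (∀ c ∈ F, e ∉ resEdges c) → Gen F l l' → Gen F (e :: l) (e :: l')
  | res {c d l l' b} : c ∈ F → d ∈ resEdges c → IsBridge c b → Gen F l l' →
      Gen F (d :: l) (b ++ l')

/-- A straight path: a path with no slipknot, i.e. crossing at most one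
    residual of each eliminated cut. -/
def Straight (F : Finset (List Tree × List Tree)) (l : List (Edge × Tree)) : Prop :=
  ¬ ∃ c ∈ F, ∃ l₁ l₂ l₃ : List (Edge × Tree), ∃ d v d' v',
      d ∈ resEdges c ∧ d' ∈ resEdges c ∧ l = l₁ ++ (d, v) :: l₂ ++ (d', v') :: l₃

/-- Independent paths: disjoint, and crossing residuals of no common
    eliminated cut. -/
def Indep (F : Finset (List Tree × List Tree)) (l₁ l₂ : List (Edge × Tree)) : Prop :=
  (∀ x ∈ l₁, ∀ y ∈ l₂, x.1 ≠ y.1) ∧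
  ¬ ∃ c ∈ F, (∃ x ∈ l₁, x.1 ∈ resEdges c) ∧ (∃ y ∈ l₂, y.1 ∈ resEdges c)

/-- `DecompWith F l cs χs ξs` : the decomposition `l = χ₁ξ₁⋯χₙξₙχₙ₊₁` of a
    path of `q` into pairwise independent straight paths `χᵢ` and slipknots
    `ξᵢ` on the pairwise distinct eliminated cuts `cs = c₁, …, cₙ`. -/
def DecompWith (F : Finset (List Tree × List Tree)) (l : List (Edge × Tree))
    (cs : List (List Tree × List Tree)) (χs ξs : List (List (Edge × Tree))) : Prop :=
  cs.Nodup ∧ (∀ c ∈ cs, c ∈ F) ∧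
  χs.length = cs.length + 1 ∧ ξs.length = cs.length ∧
  l = (List.zipWith (· ++ ·) χs (ξs ++ [[]])).flatten ∧
  (∀ x ∈ χs, Straight F x ∧ ∀ c ∈ cs, ∀ y ∈ x, y.1 ∉ resEdges c) ∧
  χs.Pairwise (Indep F) ∧
  List.Forall₂ (fun (ξ : List (Edge × Tree)) (c : List Tree × List Tree) =>
      ∃ t s t' s' mid, (t, s) ∈ c.1.zip c.2 ∧ (t', s') ∈ c.1.zip c.2 ∧ t ≠ t' ∧
        ξ = (Edge.cutE t s, s) :: mid ++ [(Edge.cutE t' s', t')]) ξs cs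

/-- `Decomp F l cs` : some decomposition of `l` along the cut sequence `cs`
    exists. -/
def Decomp (F : Finset (List Tree × List Tree)) (l : List (Edge × Tree))
    (cs : List (List Tree × List Tree)) : Prop :=
  ∃ χs ξs, DecompWith F l cs χs ξs

/-! ### α-equivalence -/

/-- A renaming of atoms: a map on variable names together with a possible
    flip of polarities (so as to commute with the involution), a map on unit
    labels and a map on counit labels. -/
structure Ren : Type where
  v : ℕ → ℕ
  vb : ℕ → Bool
  u : ℕ → ℕ
  c : ℕ → ℕ

/-- Applying a renaming to a tree. -/
def Tree.rename (r : Ren) : Tree → Tree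
  | Tree.var n b => Tree.var (r.v n) (xor b (r.vb n))
  | Tree.unit l => Tree.unit (r.u l)
  | Tree.counit l => Tree.counit (r.c l)
  | Tree.tens ts => Tree.tens (ts.attach.map (fun x => Tree.rename r x.1))
  | Tree.parr ts => Tree.parr (ts.attach.map (fun x => Tree.rename r x.1))
termination_by t => sizeOf t
decreasing_by all_goals (have h := List.sizeOf_lt_of_mem x.2; simp; omega)

/-- α-equivalence of nets: renaming of atoms (preserving the involution on
    variables) and reindexing of cuts. -/
def AlphaEq (p q : Net) : Prop :=
  ∃ r : Ren, Function.Bijective r.v ∧ Function.Bijective r.u ∧ Function.Bijective r.c ∧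
    q.cuts = p.cuts.image (fun c => (c.1.rename r, c.2.rename r)) ∧
    q.concl = p.concl.map (Tree.rename r) ∧
    (∀ m, Tree.counit m ∈ p.ST → q.jump (r.c m) = (p.jump m).rename r)

end MLLNets
namespace MLLNets

section Graph

variable {V : Type*}

/-- Connectivity in the undirected multigraph given by a list of edges. -/
def Conn (L : List (V × V)) : V → V → Prop :=
  Relation.EqvGen fun a b => (a, b) ∈ L

/-- A multigraph is a forest when its edges can be added one by one, each time
    joining two distinct connected components. -/
def Forest : List (V × V) → Prop
  | [] => True
  | e :: L => Forest L ∧ ¬ Conn L e.1 e.2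

theorem Conn.refl {L : List (V × V)} (a : V) : Conn L a a := Relation.EqvGen.refl a

theorem Conn.symm {L : List (V × V)} {a b : V} (h : Conn L a b) : Conn L b a :=
  Relation.EqvGen.symm _ _ h

theorem Conn.trans {L : List (V × V)} {a b c : V} (h : Conn L a b) (h' : Conn L b c) :
    Conn L a c :=
  Relation.EqvGen.trans _ _ _ h h'

theorem Conn.of_mem {L : List (V × V)} {a b : V} (h : (a, b) ∈ L) : Conn L a b :=
  Relation.EqvGen.rel _ _ h

theorem Conn.mono {L L' : List (V × V)} (hL : L ⊆ L') {a b : V} (h : Conn L a b) :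
    Conn L' a b :=
  Relation.EqvGen.mono (fun _ _ h => hL h) _ _ h

theorem Conn.invariant {L : List (V × V)} (C : V → Prop)
    (hC : ∀ a b, (a, b) ∈ L → (C a ↔ C b)) {u v : V} (h : Conn L u v) : C u ↔ C v := by
  induction h with
  | rel a b h => exact hC a b h
  | refl a => exact Iff.rfl
  | symm a b _ ih => exact ih.symm
  | trans a b c _ _ ih ih' => exact ih.trans ih'

theorem Conn.cons_cases {L : List (V × V)} {e : V × V} {u v : V} (h : Conn (e :: L) u v) :
    Conn L u v ∨ (Conn L u e.1 ∧ Conn L e.2 v) ∨ (Conn L u e.2 ∧ Conn L e.1 v) := by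
  obtain ⟨x, y⟩ := e
  refine (Conn.invariant (fun w => Conn L u w ∨ (Conn L u x ∧ Conn L y w) ∨
    (Conn L u y ∧ Conn L x w)) ?_ h).1 (Or.inl (Conn.refl u))
  intro a b hab
  rcases List.mem_cons.1 hab with hab | hab
  · cases hab
    constructor
    · rintro (h | ⟨h, -⟩ | ⟨h, -⟩)
      · exact Or.inr (Or.inl ⟨h, Conn.refl _⟩)
      · exact Or.inr (Or.inl ⟨h, Conn.refl _⟩)
      · exact Or.inl h
    · rintro (h | ⟨h, -⟩ | ⟨h, -⟩)
      · exact Or.inr (Or.inr ⟨h, Conn.refl _⟩)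
      · exact Or.inl h
      · exact Or.inr (Or.inr ⟨h, Conn.refl _⟩)
  · have hab := Conn.of_mem hab
    constructor
    · rintro (h | ⟨h, h'⟩ | ⟨h, h'⟩)
      · exact Or.inl (h.trans hab)
      · exact Or.inr (Or.inl ⟨h, h'.trans hab⟩)
      · exact Or.inr (Or.inr ⟨h, h'.trans hab⟩)
    · rintro (h | ⟨h, h'⟩ | ⟨h, h'⟩)
      · exact Or.inl (h.trans hab.symm)
      · exact Or.inr (Or.inl ⟨h, h'.trans hab.symm⟩)
      · exact Or.inr (Or.inr ⟨h, h'.trans hab.symm⟩)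

/-- A connection using additional edges either avoids them, or reaches one of
    their endpoints without using them. -/
theorem Conn.append_cases {A B : List (V × V)} {u v : V} (h : Conn (A ++ B) u v) :
    Conn B u v ∨ ∃ e ∈ A, Conn B u e.1 ∨ Conn B u e.2 := by
  refine (Conn.invariant (fun w => Conn B u w ∨ ∃ e ∈ A, Conn B u e.1 ∨ Conn B u e.2) ?_ h).1
    (Or.inl (Conn.refl u))
  intro a b hab
  rcases List.mem_append.1 hab with hab | hab
  · constructor
    · rintro (h | h)
      · exact Or.inr ⟨_, hab, Or.inl h⟩
      · exact Or.inr h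
    · rintro (h | h)
      · exact Or.inr ⟨_, hab, Or.inr h⟩
      · exact Or.inr h
  · have hab := Conn.of_mem hab
    exact or_congr ⟨fun h => h.trans hab, fun h => h.trans hab.symm⟩ Iff.rfl

theorem Forest.of_perm {L L' : List (V × V)} (hL : L.Perm L') (h : Forest L) : Forest L' := by
  induction hL with
  | nil => exact h
  | cons e hp ih => exact ⟨ih h.1, fun hc => h.2 (hc.mono hp.symm.subset)⟩
  | swap e f L =>
    obtain ⟨⟨hL, he⟩, hf⟩ := h
    have sub : ∀ g : V × V, L ⊆ g :: L := fun g => List.subset_cons_self g L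
    refine ⟨⟨hL, fun hc => hf (hc.mono (sub _))⟩, fun hc => ?_⟩
    have hef : Conn (e :: L) e.1 e.2 := Conn.of_mem List.mem_cons_self
    rcases hc.cons_cases with hc | ⟨h₁, h₂⟩ | ⟨h₁, h₂⟩
    · exact he hc
    · exact hf (((h₁.mono (sub e)).symm.trans hef).trans (h₂.mono (sub e)).symm)
    · exact hf ((h₂.mono (sub e)).trans (hef.symm.trans (h₁.mono (sub e))))
  | trans _ _ ih ih' => exact ih' (ih h)

theorem Forest.of_append {A B : List (V × V)} (h : Forest (A ++ B)) : Forest B := by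
  induction A with
  | nil => exact h
  | cons e A ih => exact ih h.1

theorem Forest.not_conn {A L : List (V × V)} {e : V × V} (h : Forest L)
    (hL : L.Perm (e :: A)) : ¬ Conn A e.1 e.2 :=
  (h.of_perm hL).2

end Graph

end MLLNets

namespace MLLNets

attribute [local instance] Classical.propDecidable

/-- The edges of a switching graph lying on the cut `⟨⊗(c.1)|⅋(c.2)⟩`, when the
    switching of its `⅋` is `s`. -/
def starEdges (c : List Tree × List Tree) (s : Tree) : List (Tree × Tree) :=
  (Tree.tens c.1, Tree.parr c.2) :: (Tree.parr c.2, s) ::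
    c.1.map fun t => (Tree.tens c.1, t)

/-- The edges identifying the two trees of a cut with their first premises. -/
def headEdges (c : List Tree × List Tree) : List (Tree × Tree) :=
  [(Tree.tens c.1, c.1.headI), (Tree.parr c.2, c.2.headI)]

/-- The edges replacing those of `starEdges` once the cut is eliminated; the two
    trees of the cut are kept, so that jumps need no redirection. -/
def elimEdges (c : List Tree × List Tree) : List (Tree × Tree) :=
  c.1.zip c.2 ++ headEdges c

/-- The trees of the cut `c` and their premises lie in distinct components of `B`,
    except possibly for the premises of the `⅋`. -/
structure Sep (c : List Tree × List Tree) (B : List (Tree × Tree)) : Prop where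
  left_left : ∀ t ∈ c.1, ∀ t' ∈ c.1, t ≠ t' → ¬ Conn B t t'
  left_tens : ∀ t ∈ c.1, ¬ Conn B t (Tree.tens c.1)
  left_parr : ∀ t ∈ c.1, ¬ Conn B t (Tree.parr c.2)
  left_right : ∀ t ∈ c.1, ∀ s ∈ c.2, ¬ Conn B t s
  tens_parr : ¬ Conn B (Tree.tens c.1) (Tree.parr c.2)
  tens_right : ∀ s ∈ c.2, ¬ Conn B (Tree.tens c.1) s
  parr_right : ∀ s ∈ c.2, ¬ Conn B (Tree.parr c.2) s

/-- The shape of an eliminated multiplicative cut. -/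
structure CutShape (c : List Tree × List Tree) : Prop where
  length_eq : c.1.length = c.2.length
  ne_nil : c.1 ≠ []
  nodup : c.1.Nodup

theorem headI_mem {l : List Tree} (h : l ≠ []) : l.headI ∈ l := by
  cases l with
  | nil => exact absurd rfl h
  | cons a l => exact List.mem_cons_self

theorem zip_snd_eq_of_nodup {l l' : List Tree} (h : l.Nodup) {t s s' : Tree}
    (hs : (t, s) ∈ l.zip l') (hs' : (t, s') ∈ l.zip l') : s = s' := by
  induction l generalizing l' with
  | nil => simp at hs
  | cons a l ih =>
    cases l' with
    | nil => simp at hs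
    | cons b l' =>
      rw [List.nodup_cons] at h
      simp only [List.zip_cons_cons, List.mem_cons, Prod.mk.injEq] at hs hs'
      rcases hs with ⟨rfl, rfl⟩ | hs
      · rcases hs' with ⟨-, rfl⟩ | hs'
        · rfl
        · exact absurd (List.of_mem_zip hs').1 h.1
      · rcases hs' with ⟨rfl, -⟩ | hs'
        · exact absurd (List.of_mem_zip hs).1 h.1
        · exact ih h.2 hs hs'

theorem CutShape.right_ne_nil {c : List Tree × List Tree} (hc : CutShape c) : c.2 ≠ [] := by
  intro h
  have := hc.length_eq
  rw [h, List.length_nil, List.length_eq_zero_iff] at this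
  exact hc.ne_nil this

theorem Sep.mono {c : List Tree × List Tree} {B B' : List (Tree × Tree)} (hB : B ⊆ B')
    (h : Sep c B') : Sep c B where
  left_left t ht t' ht' hne hc := h.left_left t ht t' ht' hne (hc.mono hB)
  left_tens t ht hc := h.left_tens t ht (hc.mono hB)
  left_parr t ht hc := h.left_parr t ht (hc.mono hB)
  left_right t ht s hs hc := h.left_right t ht s hs (hc.mono hB)
  tens_parr hc := h.tens_parr (hc.mono hB)
  tens_right s hs hc := h.tens_right s hs (hc.mono hB)
  parr_right s hs hc := h.parr_right s hs (hc.mono hB)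

theorem conn_tens_of_starEdges {c : List Tree × List Tree} {s y : Tree}
    {B : List (Tree × Tree)} (hy : y = Tree.tens c.1 ∨ y = Tree.parr c.2 ∨ y ∈ c.1 ∨ y = s) :
    Conn (starEdges c s ++ B) y (Tree.tens c.1) := by
  have h1 : Conn (starEdges c s ++ B) (Tree.tens c.1) (Tree.parr c.2) :=
    Conn.of_mem (by simp [starEdges])
  rcases hy with rfl | rfl | hy | rfl
  · exact Conn.refl _
  · exact h1.symm
  · exact (Conn.of_mem (by simp [starEdges, hy])).symm
  · exact (h1.trans (Conn.of_mem (by simp [starEdges]))).symm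

theorem Sep.of_forest {c : List Tree × List Tree} (hc : CutShape c) {B : List (Tree × Tree)}
    (h : ∀ s ∈ c.2, Forest (starEdges c s ++ B)) : Sep c B := by
  have key_left : ∀ t ∈ c.1, ∀ s ∈ c.2, ∀ y, y = Tree.tens c.1 ∨ y = Tree.parr c.2 ∨ y = s ∨
      (y ∈ c.1 ∧ t ≠ y) → ¬ Conn B t y := by
    intro t ht s hs y hy hcon
    obtain ⟨l, r, hlr⟩ := List.append_of_mem ht
    set A : List (Tree × Tree) := (Tree.tens c.1, Tree.parr c.2) :: (Tree.parr c.2, s) ::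
      ((l ++ r).map fun t => (Tree.tens c.1, t)) ++ B with hA
    have hperm : (starEdges c s ++ B).Perm ((Tree.tens c.1, t) :: A) := by
      have h1 : (c.1.map fun u => (Tree.tens c.1, u)).Perm
          ((t :: (l ++ r)).map fun u => (Tree.tens c.1, u)) := by
        refine List.Perm.map _ ?_
        conv_lhs => rw [hlr]
        exact List.perm_middle
      rw [hA, starEdges]
      refine ((List.Perm.cons _ (List.Perm.cons _ h1)).append_right B).trans ?_
      simp only [List.map_cons, List.cons_append]
      exact ((List.Perm.swap _ _ _).cons _).trans (List.Perm.swap _ _ _)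
    refine (h s hs).not_conn hperm ?_
    have hBA : B ⊆ A := by rw [hA]; exact List.subset_append_right _ _
    refine Conn.symm ((hcon.mono hBA).trans ?_)
    have h1 : Conn A (Tree.tens c.1) (Tree.parr c.2) := Conn.of_mem (by simp [hA])
    rcases hy with rfl | rfl | rfl | ⟨hy, hne⟩
    · exact Conn.refl _
    · exact h1.symm
    · exact (h1.trans (Conn.of_mem (by simp [hA]))).symm
    · refine (Conn.of_mem ?_).symm
      have : y ∈ l ++ r := by
        rw [hlr] at hy
        simp only [List.mem_append, List.mem_cons] at hy ⊢
        rcases hy with hy | rfl | hy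
        · exact Or.inl hy
        · exact absurd rfl hne
        · exact Or.inr hy
      simp only [hA, List.cons_append, List.mem_cons, List.mem_append, List.mem_map]
      exact Or.inr (Or.inr (Or.inl ⟨y, List.mem_append.1 this, rfl⟩))
  have hs₀ := headI_mem hc.right_ne_nil
  have key_tens : ∀ s ∈ c.2, ∀ y, y = Tree.parr c.2 ∨ y = s → ¬ Conn B (Tree.tens c.1) y := by
    intro s hs y hy hcon
    refine (h s hs).2 ((hcon.mono fun e he => ?_).trans ?_)
    · simp [he]
    · rcases hy with rfl | rfl
      · exact Conn.refl _
      · exact (Conn.of_mem (by simp)).symm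
  exact
    { left_left := fun t ht t' ht' hne => key_left t ht _ hs₀ t' (by simp [ht', hne])
      left_tens := fun t ht => key_left t ht _ hs₀ _ (by simp)
      left_parr := fun t ht => key_left t ht _ hs₀ _ (by simp)
      left_right := fun t ht s hs => key_left t ht s hs _ (by simp)
      tens_parr := key_tens _ hs₀ _ (by simp)
      tens_right := fun s hs => key_tens s hs _ (by simp)
      parr_right := fun s hs hcon =>
        (h s hs).1.2 (hcon.mono (List.subset_append_right _ _)) }

end MLLNets

namespace MLLNets

attribute [local instance] Classical.propDecidable

/-- Once the residual of the premise `t` is removed, nothing but `⊗(c.1)` is added to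
    the component of `t` by the elimination of `c`. -/
theorem Sep.conn_left {c : List Tree × List Tree} {B z : List (Tree × Tree)} (h : Sep c B)
    (hc : CutShape c) {t x : Tree} (ht : t ∈ c.1)
    (hz : ∀ e ∈ z, e.1 ∈ c.1 ∧ e.2 ∈ c.2 ∧ e.1 ≠ t) (hx : Conn (z ++ headEdges c ++ B) t x) :
    Conn B t x ∨ (t = c.1.headI ∧ Conn B (Tree.tens c.1) x) := by
  refine (Conn.invariant (fun x => Conn B t x ∨ (t = c.1.headI ∧ Conn B (Tree.tens c.1) x))
    ?_ hx).1 (Or.inl (Conn.refl t))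
  have hright : ∀ s ∈ c.2, ¬ (Conn B t s ∨ (t = c.1.headI ∧ Conn B (Tree.tens c.1) s)) := by
    rintro s hs (h' | ⟨-, h'⟩)
    · exact h.left_right t ht s hs h'
    · exact h.tens_right s hs h'
  have hleft : ∀ t' ∈ c.1, t' ≠ t →
      ¬ (Conn B t t' ∨ (t = c.1.headI ∧ Conn B (Tree.tens c.1) t')) := by
    rintro t' ht' hne (h' | ⟨-, h'⟩)
    · exact h.left_left t ht t' ht' hne.symm h'
    · exact h.left_tens t' ht' h'.symm
  intro a b hab
  rcases List.mem_append.1 hab with hab | hab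
  · rcases List.mem_append.1 hab with hab | hab
    · obtain ⟨h1, h2, h3⟩ := hz _ hab
      exact iff_of_false (hleft a h1 h3) (hright b h2)
    · simp only [headEdges, List.mem_cons, Prod.mk.injEq, List.not_mem_nil, or_false] at hab
      rcases hab with ⟨rfl, rfl⟩ | ⟨rfl, rfl⟩
      · by_cases hth : c.1.headI = t
        · exact iff_of_true (Or.inr ⟨hth.symm, Conn.refl _⟩) (Or.inl (hth ▸ Conn.refl _))
        · refine iff_of_false ?_ (hleft _ (headI_mem hc.ne_nil) hth)
          rintro (h' | ⟨h', -⟩)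
          · exact h.left_tens t ht h'
          · exact hth h'.symm
      · refine iff_of_false ?_ (hright _ (headI_mem hc.right_ne_nil))
        rintro (h' | ⟨-, h'⟩)
        · exact h.left_parr t ht h'
        · exact h.tens_parr h'
  · have hab := Conn.of_mem hab
    exact or_congr ⟨fun h => h.trans hab, fun h => h.trans hab.symm⟩
      (and_congr Iff.rfl ⟨fun h => h.trans hab, fun h => h.trans hab.symm⟩)

theorem Sep.not_conn_left_right {c : List Tree × List Tree} {B z : List (Tree × Tree)}
    (h : Sep c B) (hc : CutShape c) {t s : Tree} (ht : t ∈ c.1) (hs : s ∈ c.2)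
    (hz : ∀ e ∈ z, e.1 ∈ c.1 ∧ e.2 ∈ c.2 ∧ e.1 ≠ t) :
    ¬ Conn (z ++ headEdges c ++ B) t s := fun hx => by
  rcases h.conn_left hc ht hz hx with h' | ⟨-, h'⟩
  · exact h.left_right t ht s hs h'
  · exact h.tens_right s hs h'

theorem Sep.not_conn_left_left {c : List Tree × List Tree} {B z : List (Tree × Tree)}
    (h : Sep c B) (hc : CutShape c) {t t' : Tree} (ht : t ∈ c.1) (ht' : t' ∈ c.1)
    (hne : t ≠ t') (hz : ∀ e ∈ z, e.1 ∈ c.1 ∧ e.2 ∈ c.2 ∧ e.1 ≠ t) :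
    ¬ Conn (z ++ headEdges c ++ B) t t' := fun hx => by
  rcases h.conn_left hc ht hz hx with h' | ⟨-, h'⟩
  · exact h.left_left t ht t' ht' hne h'
  · exact h.left_tens t' ht' h'.symm

/-- Eliminating a cut preserves acyclicity. -/
theorem Forest.elim {c : List Tree × List Tree} (hc : CutShape c) {B : List (Tree × Tree)}
    (h : ∀ s ∈ c.2, Forest (starEdges c s ++ B)) : Forest (elimEdges c ++ B) := by
  have hsep := Sep.of_forest hc h
  have hB : Forest B := (h _ (headI_mem hc.right_ne_nil)).of_append
  have hheads : Forest (headEdges c ++ B) := by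
    refine ⟨⟨hB, hsep.parr_right _ (headI_mem hc.right_ne_nil)⟩, fun hcon => ?_⟩
    have hcon : Conn ((Tree.parr c.2, c.2.headI) :: B) (Tree.tens c.1) c.1.headI := hcon
    have hh := headI_mem hc.ne_nil
    rcases hcon.cons_cases with h' | ⟨h', -⟩ | ⟨h', -⟩
    · exact hsep.left_tens _ hh h'.symm
    · exact hsep.tens_parr h'
    · exact hsep.tens_right _ (headI_mem hc.right_ne_nil) h'
  have key : ∀ l l' : List Tree, l.Nodup → l ⊆ c.1 → l' ⊆ c.2 →
      Forest (l.zip l' ++ headEdges c ++ B) := by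
    intro l
    induction l with
    | nil => intro l' _ _ _; simpa using hheads
    | cons t l ih =>
      intro l' hl hlc hlc'
      cases l' with
      | nil => simpa using hheads
      | cons s l' =>
        rw [List.nodup_cons] at hl
        rw [List.cons_subset] at hlc hlc'
        refine ⟨ih l' hl.2 hlc.2 hlc'.2, hsep.not_conn_left_right hc hlc.1 hlc'.1 ?_⟩
        rintro ⟨a, b⟩ he
        obtain ⟨ha, hb⟩ := List.of_mem_zip he
        refine ⟨hlc.2 ha, hlc'.2 hb, ?_⟩
        rintro rfl
        exact hl.1 ha
  exact key c.1 c.2 hc.nodup (List.Subset.refl _) (List.Subset.refl _)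

theorem perm_append_append {α : Type*} (A B C : List α) : (A ++ (B ++ C)).Perm (B ++ (A ++ C)) := by
  rw [← List.append_assoc, ← List.append_assoc]
  exact List.perm_append_comm.append_right C

theorem Forest.elim_list (L : List (List Tree × List Tree)) (hL : L.Nodup)
    (hc : ∀ c ∈ L, CutShape c) {B : List (Tree × Tree)}
    (h : ∀ σ : List Tree × List Tree → Tree, (∀ c ∈ L, σ c ∈ c.2) →
      Forest (L.flatMap (fun c => starEdges c (σ c)) ++ B)) :
    Forest (L.flatMap elimEdges ++ B) := by
  induction L generalizing B with
  | nil => simpa using h (fun _ => default) (by simp)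
  | cons c L ih =>
    rw [List.nodup_cons] at hL
    rw [List.forall_mem_cons] at hc
    rw [List.flatMap_cons, List.append_assoc]
    refine Forest.elim hc.1 fun s hs => ?_
    refine (ih hL.2 hc.2 (B := starEdges c s ++ B) fun σ hσ => ?_).of_perm
      (perm_append_append _ _ _)
    have hne : ∀ d ∈ L, d ≠ c := fun d hd hdc => hL.1 (hdc ▸ hd)
    have := h (Function.update σ c s) (List.forall_mem_cons.2
      ⟨by simpa using hs, fun d hd => by simpa [hne d hd] using hσ d hd⟩)
    rw [List.flatMap_cons, List.append_assoc, Function.update_self] at this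
    have heq : L.flatMap (fun d => starEdges d (Function.update σ c s d)) =
        L.flatMap (fun d => starEdges d (σ d)) :=
      List.flatMap_congr fun d hd => by simp [hne d hd]
    rw [heq] at this
    exact this.of_perm (perm_append_append _ _ _)

/-- The two vertices `u`, `v` are those of the edge `{t, s}`. -/
def SameEnds (t s u v : Tree) : Prop := (u = t ∧ v = s) ∨ (u = s ∧ v = t)

theorem SameEnds.conn {t s u v : Tree} (h : SameEnds t s u v) {B : List (Tree × Tree)}
    (hB : (t, s) ∈ B) : Conn B u v := by
  rcases h with ⟨rfl, rfl⟩ | ⟨rfl, rfl⟩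
  · exact Conn.of_mem hB
  · exact (Conn.of_mem hB).symm

/-- Residuals other than those of the premises `t` and `t'`. -/
structure OtherRes (c : List Tree × List Tree) (t t' : Tree) (z : List (Tree × Tree)) :
    Prop where
  subset : z ⊆ c.1.zip c.2
  ne_left : ∀ e ∈ z, e.1 ≠ t
  ne_right : ∀ e ∈ z, e.1 ≠ t'

theorem OtherRes.left {c : List Tree × List Tree} {t t' : Tree} {z : List (Tree × Tree)}
    (h : OtherRes c t t' z) : ∀ e ∈ z, e.1 ∈ c.1 ∧ e.2 ∈ c.2 ∧ e.1 ≠ t := fun e he =>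
  ⟨(List.of_mem_zip (h.subset he)).1, (List.of_mem_zip (h.subset he)).2, h.ne_left e he⟩

theorem OtherRes.symm {c : List Tree × List Tree} {t t' : Tree} {z : List (Tree × Tree)}
    (h : OtherRes c t t' z) : OtherRes c t' t z := ⟨h.subset, h.ne_right, h.ne_left⟩

/-- A slipknot leaves its first residual, and reaches its second one, on the side of
    the premises of the `⅋`. -/
theorem Sep.slipknot {c : List Tree × List Tree} {B z : List (Tree × Tree)} (h : Sep c B)
    (hc : CutShape c) {t s t' s' u v u' v' : Tree} (hts : (t, s) ∈ c.1.zip c.2)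
    (hts' : (t', s') ∈ c.1.zip c.2) (hne : t ≠ t') (hz : OtherRes c t t' z)
    (he : SameEnds t s u v) (he' : SameEnds t' s' u' v')
    (hcon : Conn (z ++ headEdges c ++ B) v u') : (u = t ∧ v = s) ∧ u' = s' ∧ v' = t' := by
  obtain ⟨ht, hs⟩ := List.of_mem_zip hts
  obtain ⟨ht', hs'⟩ := List.of_mem_zip hts'
  rcases he with he | ⟨rfl, rfl⟩
  · refine ⟨he, ?_⟩
    rcases he' with ⟨rfl, rfl⟩ | he'
    · rw [he.2] at hcon
      exact absurd hcon.symm (h.not_conn_left_right hc ht' hs hz.symm.left)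
    · exact he'
  · rcases he' with ⟨rfl, rfl⟩ | ⟨rfl, rfl⟩
    · exact absurd hcon (h.not_conn_left_left hc ht ht' hne hz.left)
    · exact absurd hcon (h.not_conn_left_right hc ht hs' hz.left)

theorem not_well_bracketed_same {c : List Tree × List Tree} {B z : List (Tree × Tree)}
    (h : Sep c B) (hc : CutShape c) {t₁ s₁ t₂ s₂ t₃ s₃ u₁ v₁ u₂ v₂ u₃ v₃ : Tree}
    (h₁ : (t₁, s₁) ∈ c.1.zip c.2) (h₂ : (t₂, s₂) ∈ c.1.zip c.2) (h₃ : (t₃, s₃) ∈ c.1.zip c.2)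
    (h₁₂ : t₁ ≠ t₂) (h₂₃ : t₂ ≠ t₃) (hz₁ : OtherRes c t₁ t₂ z) (hz₂ : OtherRes c t₂ t₃ z)
    (he₁ : SameEnds t₁ s₁ u₁ v₁) (he₂ : SameEnds t₂ s₂ u₂ v₂) (he₃ : SameEnds t₃ s₃ u₃ v₃)
    (hχ₁ : Conn (z ++ headEdges c ++ B) v₁ u₂) (hχ₂ : Conn (z ++ headEdges c ++ B) v₂ u₃) :
    False := by
  obtain ⟨-, -, hv₂⟩ := h.slipknot hc h₁ h₂ h₁₂ hz₁ he₁ he₂ hχ₁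
  obtain ⟨⟨-, hv₂'⟩, -⟩ := h.slipknot hc h₂ h₃ h₂₃ hz₂ he₂ he₃ hχ₂
  obtain ⟨ht₂, hs₂⟩ := List.of_mem_zip h₂
  exact h.left_right t₂ ht₂ s₂ hs₂ (by rw [← hv₂, ← hv₂']; exact Conn.refl _)

theorem not_well_bracketed_ne {c d : List Tree × List Tree} {B z w : List (Tree × Tree)}
    (hc : CutShape c) (hd : CutShape d)
    (h : ∀ s ∈ c.2, ∀ s' ∈ d.2, Forest (starEdges c s ++ (starEdges d s' ++ B)))
    {t₁ s₁ t₂ s₂ t₃ s₃ t₄ s₄ u₁ v₁ u₂ v₂ u₃ v₃ u₄ v₄ : Tree}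
    (h₁ : (t₁, s₁) ∈ c.1.zip c.2) (h₂ : (t₂, s₂) ∈ d.1.zip d.2)
    (h₃ : (t₃, s₃) ∈ c.1.zip c.2) (h₄ : (t₄, s₄) ∈ d.1.zip d.2)
    (h₁₃ : t₁ ≠ t₃) (h₂₄ : t₂ ≠ t₄) (hz : OtherRes c t₁ t₃ z) (hw : OtherRes d t₂ t₄ w)
    (he₁ : SameEnds t₁ s₁ u₁ v₁) (he₂ : SameEnds t₂ s₂ u₂ v₂)
    (he₃ : SameEnds t₃ s₃ u₃ v₃) (he₄ : SameEnds t₄ s₄ u₄ v₄)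
    (hχ₁ : Conn (z ++ headEdges c ++ (w ++ headEdges d ++ B)) v₁ u₂)
    (hχ₂ : Conn (z ++ headEdges c ++ (w ++ headEdges d ++ B)) v₂ u₃)
    (hχ₃ : Conn (z ++ headEdges c ++ (w ++ headEdges d ++ B)) v₃ u₄) : False := by
  have hsepd : ∀ s ∈ c.2, Sep d (starEdges c s ++ B) := fun s hs =>
    Sep.of_forest hd fun s' hs' => (h s hs s' hs').of_perm (perm_append_append _ _ _)
  have hsepc : Sep c (elimEdges d ++ B) := Sep.of_forest hc fun s hs =>
    (Forest.elim hd (B := starEdges c s ++ B) fun s' hs' =>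
      (h s hs s' hs').of_perm (perm_append_append _ _ _)).of_perm (perm_append_append _ _ _)
  have hsepd' : Sep d (elimEdges c ++ B) := Sep.of_forest hd fun s' hs' =>
    (Forest.elim hc (B := starEdges d s' ++ B) fun s hs => h s hs s' hs').of_perm
      (perm_append_append _ _ _)
  have hsubc : z ++ headEdges c ++ (w ++ headEdges d ++ B) ⊆
      z ++ headEdges c ++ (elimEdges d ++ B) := by
    have := hw.subset
    intro e
    have := @this e
    simp only [elimEdges, List.mem_append]
    tauto
  have hsubd : z ++ headEdges c ++ (w ++ headEdges d ++ B) ⊆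
      w ++ headEdges d ++ (elimEdges c ++ B) := by
    have := hz.subset
    intro e
    have := @this e
    simp only [elimEdges, List.mem_append]
    tauto
  obtain ⟨⟨rfl, rfl⟩, rfl, rfl⟩ := hsepc.slipknot hc h₁ h₃ h₁₃ hz he₁ he₃
    (((hχ₁.mono hsubc).trans (he₂.conn (by simp [elimEdges, h₂]))).trans (hχ₂.mono hsubc))
  obtain ⟨⟨rfl, rfl⟩, rfl, rfl⟩ := hsepd'.slipknot hd h₂ h₄ h₂₄ hw he₂ he₄
    (((hχ₂.mono hsubd).trans (he₃.conn (by simp [elimEdges, h₃]))).trans (hχ₃.mono hsubd))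
  obtain ⟨ht₃, -⟩ := List.of_mem_zip h₃
  obtain ⟨ht₂, -⟩ := List.of_mem_zip h₂
  obtain ⟨-, hs₄⟩ := List.of_mem_zip h₄
  have hsepc' : Sep c (w ++ headEdges d ++ B) := hsepc.mono (by
    have := hw.subset
    intro e
    have := @this e
    simp only [elimEdges, List.mem_append]
    tauto)
  obtain ⟨s, hs, hs'⟩ : ∃ s ∈ c.2, Conn (starEdges c s ++ (w ++ headEdges d ++ B))
      u₂ (Tree.tens c.1) := by
    have aux : ∀ y, (y = Tree.tens c.1 ∨ y = Tree.parr c.2 ∨ y ∈ c.1 ∨ y ∈ c.2) →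
        Conn (w ++ headEdges d ++ B) u₂ y → ∃ s ∈ c.2,
        Conn (starEdges c s ++ (w ++ headEdges d ++ B)) u₂ (Tree.tens c.1) := by
      intro y hy hcon
      by_cases hyc : y ∈ c.2
      · exact ⟨y, hyc, (hcon.mono (List.subset_append_right _ _)).trans
          (conn_tens_of_starEdges (by simp))⟩
      · exact ⟨_, headI_mem hc.right_ne_nil, (hcon.mono (List.subset_append_right _ _)).trans
          (conn_tens_of_starEdges (by tauto))⟩
    have hhead := headI_mem hc.ne_nil
    have hhead' := headI_mem hc.right_ne_nil
    rcases hχ₁.symm.append_cases with h' | ⟨⟨a, b⟩, he, h'⟩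
    · exact aux _ (Or.inr (Or.inr (Or.inr (List.of_mem_zip h₁).2))) h'
    · rcases List.mem_append.1 he with he | he
      · obtain ⟨ha, hb⟩ := List.of_mem_zip (hz.subset he)
        rcases h' with h' | h'
        · exact aux _ (by tauto) h'
        · exact aux _ (by tauto) h'
      · simp only [headEdges, List.mem_cons, Prod.mk.injEq, List.not_mem_nil, or_false] at he
        rcases he with ⟨rfl, rfl⟩ | ⟨rfl, rfl⟩ <;> rcases h' with h' | h'
        · exact aux _ (Or.inl rfl) h'
        · exact aux _ (by tauto) h'
        · exact aux _ (Or.inr (Or.inl rfl)) h'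
        · exact aux _ (by tauto) h'
  have hcon : Conn (starEdges c s ++ (w ++ headEdges d ++ B)) (Tree.tens c.1) u₄ := by
    rcases hsepc'.conn_left hc ht₃ hz.symm.left hχ₃ with h' | ⟨-, h'⟩
    · exact (conn_tens_of_starEdges (by tauto)).symm.trans
        (h'.mono (List.subset_append_right _ _))
    · exact h'.mono (List.subset_append_right _ _)
  refine (hsepd s hs).not_conn_left_right hd ht₂ hs₄ hw.left ((hs'.trans hcon).mono ?_)
  exact (perm_append_append _ _ _).subset

end MLLNets

namespace MLLNets

attribute [local instance] Classical.propDecidable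

namespace Tree

theorem mem_foldr_union {α : Type*} {L : List (Finset α)} {x : α} :
    x ∈ L.foldr (· ∪ ·) ∅ ↔ ∃ s ∈ L, x ∈ s := by
  induction L with
  | nil => simp
  | cons a L ih => simp [ih]

theorem mem_ST_tens {ts : List Tree} {u : Tree} :
    u ∈ (tens ts).ST ↔ u = tens ts ∨ ∃ t ∈ ts, u ∈ t.ST := by
  rw [ST, Finset.mem_insert, mem_foldr_union]
  simp

theorem mem_ST_parr {ts : List Tree} {u : Tree} :
    u ∈ (parr ts).ST ↔ u = parr ts ∨ ∃ t ∈ ts, u ∈ t.ST := by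
  rw [ST, Finset.mem_insert, mem_foldr_union]
  simp

theorem atoms_tens (ts : List Tree) : (tens ts).atoms = (ts.map atoms).sum := by
  rw [atoms]
  simp

theorem atoms_parr (ts : List Tree) : (parr ts).atoms = (ts.map atoms).sum := by
  rw [atoms]
  simp

/-- Induction on trees, with an induction hypothesis for each premise. -/
theorem premise_induction {P : Tree → Prop} (hv : ∀ n b, P (var n b)) (hu : ∀ l, P (unit l))
    (hc : ∀ l, P (counit l)) (ht : ∀ ts, (∀ t ∈ ts, P t) → P (tens ts))
    (hp : ∀ ts, (∀ t ∈ ts, P t) → P (parr ts)) : ∀ t, P t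
  | var n b => hv n b
  | unit l => hu l
  | counit l => hc l
  | tens ts => ht ts fun t _ => premise_induction hv hu hc ht hp t
  | parr ts => hp ts fun t _ => premise_induction hv hu hc ht hp t

theorem mem_ST_self (t : Tree) : t ∈ t.ST := by
  cases t <;> simp [ST]

theorem ST_trans {t u : Tree} (h : u ∈ t.ST) : u.ST ⊆ t.ST := by
  induction t using premise_induction with
  | hv n b => simp only [ST, Finset.mem_singleton] at h; rw [h]
  | hu l => simp only [ST, Finset.mem_singleton] at h; rw [h]
  | hc l => simp only [ST, Finset.mem_singleton] at h; rw [h]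
  | ht ts ih =>
    rcases mem_ST_tens.1 h with rfl | ⟨t, ht, hu⟩
    · exact Finset.Subset.refl _
    · exact fun x hx => mem_ST_tens.2 (Or.inr ⟨t, ht, ih t ht hu hx⟩)
  | hp ts ih =>
    rcases mem_ST_parr.1 h with rfl | ⟨t, ht, hu⟩
    · exact Finset.Subset.refl _
    · exact fun x hx => mem_ST_parr.2 (Or.inr ⟨t, ht, ih t ht hu hx⟩)

theorem atoms_le_sum {ts : List Tree} {t : Tree} (h : t ∈ ts) :
    t.atoms ≤ (ts.map atoms).sum :=
  List.single_le_sum (fun _ _ => Multiset.zero_le _) _ (List.mem_map_of_mem h)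

theorem atoms_le_of_mem_ST {t u : Tree} (h : u ∈ t.ST) : u.atoms ≤ t.atoms := by
  induction t using premise_induction with
  | hv n b => simp only [ST, Finset.mem_singleton] at h; rw [h]
  | hu l => simp only [ST, Finset.mem_singleton] at h; rw [h]
  | hc l => simp only [ST, Finset.mem_singleton] at h; rw [h]
  | ht ts ih =>
    rcases mem_ST_tens.1 h with rfl | ⟨t, ht, hu⟩
    · exact le_rfl
    · exact (ih t ht hu).trans (atoms_tens ts ▸ atoms_le_sum ht)
  | hp ts ih =>
    rcases mem_ST_parr.1 h with rfl | ⟨t, ht, hu⟩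
    · exact le_rfl
    · exact (ih t ht hu).trans (atoms_parr ts ▸ atoms_le_sum ht)

theorem sizeOf_le_of_mem_ST {t u : Tree} (h : u ∈ t.ST) : sizeOf u ≤ sizeOf t := by
  induction t using premise_induction with
  | hv n b => simp only [ST, Finset.mem_singleton] at h; rw [h]
  | hu l => simp only [ST, Finset.mem_singleton] at h; rw [h]
  | hc l => simp only [ST, Finset.mem_singleton] at h; rw [h]
  | ht ts ih =>
    rcases mem_ST_tens.1 h with rfl | ⟨t, ht, hu⟩
    · exact le_rfl
    · have h1 := ih t ht hu
      have h2 := List.sizeOf_lt_of_mem ht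
      simp only [tens.sizeOf_spec]
      omega
  | hp ts ih =>
    rcases mem_ST_parr.1 h with rfl | ⟨t, ht, hu⟩
    · exact le_rfl
    · have h1 := ih t ht hu
      have h2 := List.sizeOf_lt_of_mem ht
      simp only [parr.sizeOf_spec]
      omega

end Tree

namespace Net

theorem mem_ST {p : Net} {u : Tree} :
    u ∈ p.ST ↔ (∃ c ∈ p.cuts, u ∈ c.1.ST ∨ u ∈ c.2.ST) ∨ ∃ t ∈ p.concl, u ∈ t.ST := by
  rw [ST, Finset.mem_union, Tree.mem_foldr_union]
  simp [Finset.mem_biUnion]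

theorem ST_trans {p : Net} {t u : Tree} (ht : t ∈ p.ST) (hu : u ∈ t.ST) : u ∈ p.ST := by
  rw [mem_ST] at ht ⊢
  rcases ht with ⟨c, hc, h | h⟩ | ⟨s, hs, h⟩
  · exact Or.inl ⟨c, hc, Or.inl (Tree.ST_trans h hu)⟩
  · exact Or.inl ⟨c, hc, Or.inr (Tree.ST_trans h hu)⟩
  · exact Or.inr ⟨s, hs, Tree.ST_trans h hu⟩

theorem mem_ST_of_mem_tens {p : Net} {ts : List Tree} {t : Tree} (h : Tree.tens ts ∈ p.ST)
    (ht : t ∈ ts) : t ∈ p.ST :=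
  ST_trans h (Tree.mem_ST_tens.2 (Or.inr ⟨t, ht, t.mem_ST_self⟩))

theorem mem_ST_of_mem_parr {p : Net} {ts : List Tree} {t : Tree} (h : Tree.parr ts ∈ p.ST)
    (ht : t ∈ ts) : t ∈ p.ST :=
  ST_trans h (Tree.mem_ST_parr.2 (Or.inr ⟨t, ht, t.mem_ST_self⟩))

theorem left_mem_ST {p : Net} {t s : Tree} (h : (t, s) ∈ p.cuts) : t ∈ p.ST :=
  mem_ST.2 (Or.inl ⟨_, h, Or.inl t.mem_ST_self⟩)

theorem right_mem_ST {p : Net} {t s : Tree} (h : (t, s) ∈ p.cuts) : s ∈ p.ST :=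
  mem_ST.2 (Or.inl ⟨_, h, Or.inr s.mem_ST_self⟩)

theorem IsMLL.exists_atom {p : Net} (hp : p.IsMLL) {t : Tree} (ht : t ∈ p.ST) :
    ∃ a, a ∈ t.atoms := by
  induction t using Tree.premise_induction with
  | hv n b => simp [Tree.atoms]
  | hu l => simp [Tree.atoms]
  | hc l => simp [Tree.atoms]
  | ht ts ih =>
    obtain ⟨t, hts⟩ := List.exists_mem_of_ne_nil ts (hp.2.1 ts ht)
    obtain ⟨a, ha⟩ := ih t hts (mem_ST_of_mem_tens ht hts)
    exact ⟨a, Multiset.mem_of_le (Tree.atoms_tens ts ▸ Tree.atoms_le_sum hts) ha⟩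
  | hp ts ih =>
    obtain ⟨t, hts⟩ := List.exists_mem_of_ne_nil ts (hp.2.2.1 ts ht)
    obtain ⟨a, ha⟩ := ih t hts (mem_ST_of_mem_parr ht hts)
    exact ⟨a, Multiset.mem_of_le (Tree.atoms_parr ts ▸ Tree.atoms_le_sum hts) ha⟩

theorem atoms_nodup_cuts {p : Net} (hp : p.IsMLL) :
    (p.cuts.val.bind fun c => c.1.atoms + c.2.atoms).Nodup :=
  (Multiset.nodup_add.1 hp.1).1

theorem IsMLL.cut_unique {p : Net} (hp : p.IsMLL) {x y : Tree × Tree} (hx : x ∈ p.cuts)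
    (hy : y ∈ p.cuts) {a : Atom} (hax : a ∈ x.1.atoms + x.2.atoms)
    (hay : a ∈ y.1.atoms + y.2.atoms) : x = y := by
  by_contra hne
  have : Std.Symm (Function.onFun Disjoint fun c : Tree × Tree => c.1.atoms + c.2.atoms) :=
    ⟨fun _ _ h => Disjoint.symm h⟩
  have h := (Multiset.nodup_bind.1 (atoms_nodup_cuts hp)).2.forall hx hy hne
  exact Multiset.disjoint_left.1 h hax hay

theorem IsMLL.cut_nodup {p : Net} (hp : p.IsMLL) {x : Tree × Tree} (hx : x ∈ p.cuts) :
    (x.1.atoms + x.2.atoms).Nodup :=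
  (Multiset.nodup_bind.1 (atoms_nodup_cuts hp)).1 x hx

theorem IsMLL.not_mem_concl {p : Net} (hp : p.IsMLL) {x : Tree × Tree} (hx : x ∈ p.cuts)
    {a : Atom} (hax : a ∈ x.1.atoms + x.2.atoms) {t : Tree} (ht : t ∈ p.concl) :
    a ∉ t.atoms := fun hat =>
  Multiset.disjoint_left.1 (Multiset.nodup_add.1 hp.1).2.2
    (Multiset.mem_bind.2 ⟨x, hx, hax⟩) (Multiset.mem_of_le (Tree.atoms_le_sum ht) hat)

theorem IsMLL.tens_nodup {p : Net} (hp : p.IsMLL) {ts : List Tree} (h : Tree.tens ts ∈ p.ST)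
    (hts : (Tree.tens ts).atoms.Nodup) : ts.Nodup := by
  rw [List.nodup_iff_sublist]
  intro t hsub
  obtain ⟨a, ha⟩ := hp.exists_atom (mem_ST_of_mem_tens h (hsub.subset (List.mem_cons_self (a := t))))
  rw [Tree.atoms_tens] at hts
  have hle : ([t, t].map Tree.atoms).sum ≤ (ts.map Tree.atoms).sum :=
    (hsub.map _).sum_le_sum fun _ _ => Multiset.zero_le _
  have h2 := Multiset.nodup_of_le hle hts
  simp only [List.map_cons, List.map_nil, List.sum_cons, List.sum_nil, add_zero] at h2
  exact Multiset.disjoint_left.1 (Multiset.nodup_add.1 h2).2.2 ha ha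

end Net

end MLLNets

namespace MLLNets

attribute [local instance] Classical.propDecidable

namespace Net

/-- The endpoints of an edge in the switching graph of `p` determined by `I`. -/
def ends (p : Net) (I : Tree → Tree) : Edge → Tree × Tree
  | Edge.ax n => (Tree.var n true, Tree.var n false)
  | Edge.tensE t u => (t, u)
  | Edge.parrE t => (t, I t)
  | Edge.jumpE m => (Tree.counit m, p.jump m)
  | Edge.cutE t s => (t, s)

theorem Adj.ends_eq {p : Net} {I : Tree → Tree} {e : Edge} {t u : Tree} (h : p.Adj I e t u) :
    p.ends I e = (t, u) ∨ p.ends I e = (u, t) := by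
  induction h with
  | symm _ ih => exact ih.symm
  | _ => exact Or.inl rfl

theorem Adj.eq_or_eq {p : Net} {I : Tree → Tree} {e : Edge} {t u x w : Tree}
    (h : p.Adj I e t u) (h' : p.Adj I e x w) : w = t ∨ w = u := by
  rcases h.ends_eq with h | h <;> rcases h'.ends_eq with h' | h' <;> rw [h] at h' <;>
    cases h' <;> simp

theorem Adj.mem_ST {p : Net} (hp : p.IsMLL) {I : Tree → Tree} (hI : p.IsSwitching I)
    {e : Edge} {t u : Tree} (h : p.Adj I e t u) : t ∈ p.ST ∧ u ∈ p.ST := by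
  induction h with
  | ax n h h' => exact ⟨h, h'⟩
  | tens h ht => exact ⟨h, mem_ST_of_mem_tens h ht⟩
  | parr h => exact ⟨h, mem_ST_of_mem_parr h (hI _ h)⟩
  | jump h => exact ⟨h, hp.2.2.2.2 _ h⟩
  | cut h => exact ⟨left_mem_ST h, right_mem_ST h⟩
  | symm _ ih => exact ih.symm

theorem IsTrail.exists_suffix {p : Net} {I : Tree → Tree} {e : Edge} {u : Tree}
    {l : List (Edge × Tree)} (h : p.IsTrail I u l) (he : e ∈ l.map Prod.fst) :
    ∃ x w l', p.Adj I e x w ∧ p.IsTrail I w l' ∧ e ∉ l'.map Prod.fst ∧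
      (l'.map Prod.snd).getLastD w = (l.map Prod.snd).getLastD u ∧
      l'.map Prod.fst ⊆ l.map Prod.fst := by
  induction h with
  | nil t ht => simp at he
  | @cons t e' u l hadj htr hne ih =>
    by_cases hee : e = e'
    · subst hee
      refine ⟨t, u, l, hadj, htr, ?_, by rw [List.map_cons, List.getLastD_cons], by simp⟩
      rw [List.mem_map]
      rintro ⟨x, hx, hxe⟩
      exact hne x hx hxe
    · obtain ⟨x, w, l', h1, h2, h3, h4, h5⟩ :=
        ih (by simpa [hee] using he)
      exact ⟨x, w, l', h1, h2, h3, by rw [List.map_cons, List.getLastD_cons]; exact h4,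
        List.Subset.trans h5 (by rw [List.map_cons]; exact List.subset_cons_self _ _)⟩

/-- A trail can be extended by an edge, up to cutting off a loop. -/
theorem IsTrail.exists_cons {p : Net} {I : Tree → Tree} {e : Edge} {t u v : Tree}
    {S : List Edge} (heS : e ∈ S) (hadj : p.Adj I e t u)
    (h : ∃ l, p.IsTrail I u l ∧ (l.map Prod.snd).getLastD u = v ∧ l.map Prod.fst ⊆ S) :
    ∃ l, p.IsTrail I t l ∧ (l.map Prod.snd).getLastD t = v ∧ l.map Prod.fst ⊆ S := by
  obtain ⟨l, hl, hv, hS⟩ := h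
  by_cases he : e ∈ l.map Prod.fst
  · obtain ⟨x, w, l', h1, h2, h3, h4, h5⟩ := hl.exists_suffix he
    rcases hadj.eq_or_eq h1 with rfl | rfl
    · exact ⟨l', h2, h4.trans hv, List.Subset.trans h5 hS⟩
    · refine ⟨(e, w) :: l', .cons hadj h2 ?_, by rw [List.map_cons, List.getLastD_cons]; exact h4.trans hv, ?_⟩
      · rintro y hy rfl
        exact h3 (List.mem_map_of_mem hy)
      · rw [List.map_cons, List.cons_subset]
        exact ⟨heS, List.Subset.trans h5 hS⟩
  · refine ⟨(e, u) :: l, .cons hadj hl ?_, by rw [List.map_cons, List.getLastD_cons]; exact hv, ?_⟩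
    · rintro y hy rfl
      exact he (List.mem_map_of_mem hy)
    · rw [List.map_cons, List.cons_subset]
      exact ⟨heS, hS⟩

theorem exists_trail_of_conn {p : Net} {I : Tree → Tree} {L : List (Edge × Tree × Tree)}
    (hL : ∀ x ∈ L, p.Adj I x.1 x.2.1 x.2.2) {u v : Tree} (hv : v ∈ p.ST)
    (h : Conn (L.map Prod.snd) u v) :
    ∃ l, p.IsTrail I u l ∧ (l.map Prod.snd).getLastD u = v ∧
      l.map Prod.fst ⊆ L.map Prod.fst := by
  refine (Conn.invariant (fun w => ∃ l, p.IsTrail I w l ∧ (l.map Prod.snd).getLastD w = v ∧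
    l.map Prod.fst ⊆ L.map Prod.fst) ?_ h).2 ⟨[], .nil v hv, by simp, by simp⟩
  intro a b hab
  obtain ⟨⟨e, x, y⟩, hx, hxy⟩ := List.mem_map.1 hab
  cases hxy
  have he : e ∈ L.map Prod.fst := List.mem_map_of_mem hx
  exact ⟨IsTrail.exists_cons he (hL _ hx).symm, IsTrail.exists_cons he (hL _ hx)⟩

/-- Distinct edges of a switching graph of an acyclic net form a forest. -/
theorem IsAcyclic.forest {p : Net} (hp : p.IsMLL) (hpa : p.IsAcyclic) {I : Tree → Tree}
    (hI : p.IsSwitching I) (L : List (Edge × Tree × Tree)) (hnd : (L.map Prod.fst).Nodup)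
    (hL : ∀ x ∈ L, p.Adj I x.1 x.2.1 x.2.2) : Forest (L.map Prod.snd) := by
  induction L with
  | nil => trivial
  | cons x L ih =>
    rw [List.map_cons, List.nodup_cons] at hnd
    rw [List.forall_mem_cons] at hL
    refine ⟨ih hnd.2 hL.2, fun hcon => ?_⟩
    obtain ⟨l, hl, hlast, hsub⟩ := exists_trail_of_conn hL.2 (hL.1.mem_ST hp hI).1 hcon.symm
    have htr : p.IsTrail I x.2.1 ((x.1, x.2.2) :: l) := .cons hL.1 hl fun y hy hyx =>
      hnd.1 (hyx ▸ hsub (List.mem_map_of_mem hy))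
    have := hpa I hI _ _ htr
    rw [List.map_cons, List.nodup_cons] at this
    refine this.1 ?_
    have hmem := List.getLastD_mem_cons (l := l.map Prod.snd) (a := x.2.2)
    rwa [hlast] at hmem

theorem IsTrail.nodup {q : Net} {J : Tree → Tree} {t : Tree} {l : List (Edge × Tree)}
    (h : q.IsTrail J t l) : (l.map Prod.fst).Nodup := by
  induction h with
  | nil => simp
  | cons _ _ hne ih =>
    rw [List.map_cons, List.nodup_cons]
    refine ⟨?_, ih⟩
    rw [List.mem_map]
    rintro ⟨x, hx, hxe⟩
    exact hne x hx hxe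

theorem IsTrail.exists_adj {q : Net} {J : Tree → Tree} {t : Tree} {l : List (Edge × Tree)}
    (h : q.IsTrail J t l) : ∀ e ∈ l.map Prod.fst, ∃ u v, q.Adj J e u v := by
  induction h with
  | nil => simp
  | cons hadj _ _ ih => simpa using ⟨⟨_, _, hadj⟩, by simpa using ih⟩

theorem IsTrail.conn_append {q : Net} {J : Tree → Tree} {G : List (Tree × Tree)} {t : Tree}
    {l l' : List (Edge × Tree)} (h : q.IsTrail J t (l ++ l'))
    (hG : ∀ e ∈ l.map Prod.fst, ∀ u v, q.Adj J e u v → Conn G u v) :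
    ∃ u, Conn G t u ∧ q.IsTrail J u l' := by
  induction l generalizing t with
  | nil => exact ⟨t, Conn.refl t, h⟩
  | cons x l ih =>
    rw [List.map_cons, List.forall_mem_cons] at hG
    cases h with
    | cons hadj htr _ =>
      obtain ⟨u, hu, htr'⟩ := ih htr hG.2
      exact ⟨u, (hG.1 _ _ hadj).trans hu, htr'⟩

end Net

theorem mem_melim {F : Finset (List Tree × List Tree)} {x : Tree × Tree} :
    x ∈ melim F ↔ ∃ c ∈ F, x = (Tree.tens c.1, Tree.parr c.2) ∨
      x = (Tree.parr c.2, Tree.tens c.1) := by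
  simp [melim]

theorem mem_resEdges {c : List Tree × List Tree} {e : Edge} :
    e ∈ resEdges c ↔ ∃ t s, (t, s) ∈ c.1.zip c.2 ∧ e = Edge.cutE t s := by
  simp [resEdges, eq_comm]

namespace ParStepF

variable {p q : Net} {F : Finset (List Tree × List Tree)}

theorem mem_cuts (h : ParStepF p q F [] []) {x : Tree × Tree} :
    x ∈ q.cuts ↔ (x ∈ p.cuts ∧ x ∉ melim F) ∨ ∃ c ∈ F, x ∈ c.1.zip c.2 := by
  rw [h.hcuts]
  simp [Tree.substList, aelim, eelim, mres]

theorem concl_eq (h : ParStepF p q F [] []) : q.concl = p.concl := by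
  rw [h.hconcl]
  exact (List.map_congr_left fun _ _ => rfl).trans (List.map_id _)

theorem exists_cut (h : ParStepF p q F [] []) {c : List Tree × List Tree} (hc : c ∈ F) :
    ∃ x ∈ p.cuts, x = (Tree.tens c.1, Tree.parr c.2) ∨ x = (Tree.parr c.2, Tree.tens c.1) := by
  rcases (h.hF c hc).2.2 with h | h
  · exact ⟨_, h, Or.inl rfl⟩
  · exact ⟨_, h, Or.inr rfl⟩

theorem tens_mem_ST (h : ParStepF p q F [] []) {c : List Tree × List Tree} (hc : c ∈ F) :
    Tree.tens c.1 ∈ p.ST := by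
  rcases (h.hF c hc).2.2 with h | h
  · exact Net.left_mem_ST h
  · exact Net.right_mem_ST h

theorem parr_mem_ST (h : ParStepF p q F [] []) {c : List Tree × List Tree} (hc : c ∈ F) :
    Tree.parr c.2 ∈ p.ST := by
  rcases (h.hF c hc).2.2 with h | h
  · exact Net.right_mem_ST h
  · exact Net.left_mem_ST h

theorem ST_subset (h : ParStepF p q F [] []) : q.ST ⊆ p.ST := by
  intro u hu
  rcases Net.mem_ST.1 hu with ⟨x, hx, hux⟩ | ⟨t, ht, hut⟩
  · rcases h.mem_cuts.1 hx with ⟨hx, -⟩ | ⟨c, hc, hx⟩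
    · exact Net.mem_ST.2 (Or.inl ⟨x, hx, hux⟩)
    · obtain ⟨h1, h2⟩ := List.of_mem_zip hx
      rcases hux with hux | hux
      · exact Net.ST_trans (Net.mem_ST_of_mem_tens (h.tens_mem_ST hc) h1) hux
      · exact Net.ST_trans (Net.mem_ST_of_mem_parr (h.parr_mem_ST hc) h2) hux
  · exact Net.mem_ST.2 (Or.inr ⟨t, h.concl_eq ▸ ht, hut⟩)

/-- An atom of an eliminated cut belongs to no other eliminated cut. -/
theorem eq_of_mem_atoms (h : ParStepF p q F [] []) (hp : p.IsMLL)
    {c d : List Tree × List Tree} (hc : c ∈ F) (hd : d ∈ F) {a : Atom}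
    (hac : a ∈ (Tree.tens c.1).atoms + (Tree.parr c.2).atoms)
    (had : a ∈ (Tree.tens d.1).atoms + (Tree.parr d.2).atoms) : c = d := by
  obtain ⟨x, hx, hxc⟩ := h.exists_cut hc
  obtain ⟨y, hy, hyd⟩ := h.exists_cut hd
  have hxy : x = y := hp.cut_unique hx hy
    (by rcases hxc with rfl | rfl <;> simpa [or_comm] using hac)
    (by rcases hyd with rfl | rfl <;> simpa [or_comm] using had)
  subst hxy
  rcases hxc with rfl | rfl <;> rcases hyd with h' | h' <;> simp at h'
  · exact Prod.ext h'.1 h'.2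
  · exact Prod.ext h'.2 h'.1

theorem atoms_disjoint (h : ParStepF p q F [] []) (hp : p.IsMLL)
    {c : List Tree × List Tree} (hc : c ∈ F) :
    ((Tree.tens c.1).atoms + (Tree.parr c.2).atoms).Nodup := by
  obtain ⟨x, hx, rfl | rfl⟩ := h.exists_cut hc
  · exact hp.cut_nodup hx
  · rw [add_comm]
    exact hp.cut_nodup hx

theorem tens_injective (h : ParStepF p q F [] []) (hp : p.IsMLL)
    {c d : List Tree × List Tree} (hc : c ∈ F) (hd : d ∈ F) (hcd : c.1 = d.1) : c = d := by
  obtain ⟨a, ha⟩ := hp.exists_atom (h.tens_mem_ST hc)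
  exact h.eq_of_mem_atoms hp hc hd (Multiset.mem_add.2 (Or.inl ha))
    (Multiset.mem_add.2 (Or.inl (hcd ▸ ha)))

theorem parr_injective (h : ParStepF p q F [] []) (hp : p.IsMLL)
    {c d : List Tree × List Tree} (hc : c ∈ F) (hd : d ∈ F) (hcd : c.2 = d.2) : c = d := by
  obtain ⟨a, ha⟩ := hp.exists_atom (h.parr_mem_ST hc)
  exact h.eq_of_mem_atoms hp hc hd (Multiset.mem_add.2 (Or.inr ha))
    (Multiset.mem_add.2 (Or.inr (hcd ▸ ha)))

theorem cutShape (h : ParStepF p q F [] []) (hp : p.IsMLL)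
    {c : List Tree × List Tree} (hc : c ∈ F) : CutShape c where
  length_eq := (h.hF c hc).1
  ne_nil := (h.hF c hc).2.1
  nodup := hp.tens_nodup (h.tens_mem_ST hc)
    (Multiset.nodup_of_le (Multiset.le_add_right _ _) (h.atoms_disjoint hp hc))

/-- The trees of eliminated cuts are not subtrees of the reduct. -/
theorem not_mem_ST (h : ParStepF p q F [] []) (hp : p.IsMLL)
    {c : List Tree × List Tree} (hc : c ∈ F) {u : Tree}
    (hu : u = Tree.tens c.1 ∨ u = Tree.parr c.2) : u ∉ q.ST := by
  intro huq
  obtain ⟨a, ha⟩ := hp.exists_atom (h.ST_subset huq)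
  obtain ⟨x, hx, hxc⟩ := h.exists_cut hc
  have hac : a ∈ (Tree.tens c.1).atoms + (Tree.parr c.2).atoms := by
    rcases hu with rfl | rfl <;> simp [ha]
  have hax : a ∈ x.1.atoms + x.2.atoms := by
    rcases hxc with rfl | rfl <;> simpa [or_comm] using hac
  rcases Net.mem_ST.1 huq with ⟨y, hy, huy⟩ | ⟨t, ht, hut⟩
  · rcases h.mem_cuts.1 hy with ⟨hy, hym⟩ | ⟨d, hd, hy⟩
    · refine hym (mem_melim.2 ⟨c, hc, ?_⟩)
      have : x = y := hp.cut_unique hx hy hax <| by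
        rw [Multiset.mem_add]
        exact huy.imp (fun h => Multiset.mem_of_le (Tree.atoms_le_of_mem_ST h) ha)
          (fun h => Multiset.mem_of_le (Tree.atoms_le_of_mem_ST h) ha)
      exact this ▸ hxc
    · obtain ⟨t, s⟩ := y
      obtain ⟨ht, hs⟩ := List.of_mem_zip hy
      have ht' : t.atoms ≤ (Tree.tens d.1).atoms :=
        Tree.atoms_tens d.1 ▸ Tree.atoms_le_sum ht
      have hs' : s.atoms ≤ (Tree.parr d.2).atoms :=
        Tree.atoms_parr d.2 ▸ Tree.atoms_le_sum hs
      have hside : a ∈ (Tree.tens d.1).atoms ∧ u ∈ t.ST ∨ a ∈ (Tree.parr d.2).atoms ∧ u ∈ s.ST :=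
        huy.imp (fun h => ⟨Multiset.mem_of_le ((Tree.atoms_le_of_mem_ST h).trans ht') ha, h⟩)
          (fun h => ⟨Multiset.mem_of_le ((Tree.atoms_le_of_mem_ST h).trans hs') ha, h⟩)
      obtain rfl : c = d := h.eq_of_mem_atoms hp hc hd hac
        (Multiset.mem_add.2 (hside.imp And.left And.left))
      have hdisj : a ∈ (Tree.tens c.1).atoms → a ∉ (Tree.parr c.2).atoms := fun h1 h2 =>
        Multiset.disjoint_left.1 (Multiset.nodup_add.1 (h.atoms_disjoint hp hc)).2.2 h1 h2
      rcases hu with rfl | rfl <;> rcases hside with ⟨ha', hu⟩ | ⟨ha', hu⟩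
      · have h1 := Tree.sizeOf_le_of_mem_ST hu
        have h2 := List.sizeOf_lt_of_mem ht
        simp only [Tree.tens.sizeOf_spec] at h1
        omega
      · exact hdisj ha ha'
      · exact hdisj ha' ha
      · have h1 := Tree.sizeOf_le_of_mem_ST hu
        have h2 := List.sizeOf_lt_of_mem hs
        simp only [Tree.parr.sizeOf_spec] at h1
        omega
  · exact hp.not_mem_concl hx hax (h.concl_eq ▸ ht)
      (Multiset.mem_of_le (Tree.atoms_le_of_mem_ST hut) ha)

end ParStepF

end MLLNets

namespace MLLNets

attribute [local instance] Classical.propDecidable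

/-- The name in `p` of the cut edge of `c`. -/
noncomputable def cutLabel (p : Net) (c : List Tree × List Tree) : Edge :=
  if (Tree.tens c.1, Tree.parr c.2) ∈ p.cuts then Edge.cutE (Tree.tens c.1) (Tree.parr c.2)
  else Edge.cutE (Tree.parr c.2) (Tree.tens c.1)

/-- The edges of `starEdges c s`, together with their names in `p`. -/
noncomputable def starLabelled (p : Net) (c : List Tree × List Tree) (s : Tree) :
    List (Edge × Tree × Tree) :=
  (cutLabel p c, Tree.tens c.1, Tree.parr c.2) :: (Edge.parrE (Tree.parr c.2), Tree.parr c.2, s) ::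
    c.1.map fun t => (Edge.tensE (Tree.tens c.1) t, Tree.tens c.1, t)

/-- The edges among `l` that are not residuals, with their ends in `p`. -/
noncomputable def keptEdges (p : Net) (F : Finset (List Tree × List Tree)) (J : Tree → Tree)
    (l : List Edge) : List (Edge × Tree × Tree) :=
  (l.filter fun e => ∀ c ∈ F, e ∉ resEdges c).map fun e => (e, p.ends J e)

theorem cutLabel_eq (p : Net) (c : List Tree × List Tree) :
    cutLabel p c = Edge.cutE (Tree.tens c.1) (Tree.parr c.2) ∨
      cutLabel p c = Edge.cutE (Tree.parr c.2) (Tree.tens c.1) := by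
  rw [cutLabel]
  split_ifs <;> simp

theorem map_snd_starLabelled (p : Net) (c : List Tree × List Tree) (s : Tree) :
    (starLabelled p c s).map Prod.snd = starEdges c s := by
  simp [starLabelled, starEdges]

theorem mem_map_fst_starLabelled {p : Net} {c : List Tree × List Tree} {s : Tree} {e : Edge} :
    e ∈ (starLabelled p c s).map Prod.fst ↔ e = cutLabel p c ∨ e = Edge.parrE (Tree.parr c.2) ∨
      ∃ t ∈ c.1, Edge.tensE (Tree.tens c.1) t = e := by
  simp [starLabelled]

theorem nodup_map_fst_starLabelled (p : Net) {c : List Tree × List Tree} (hc : c.1.Nodup)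
    (s : Tree) : ((starLabelled p c s).map Prod.fst).Nodup := by
  have h : ((c.1.map fun t => (Edge.tensE (Tree.tens c.1) t, Tree.tens c.1, t)).map
      Prod.fst).Nodup := by
    rw [List.map_map]
    exact hc.map fun t t' htt => by simpa using htt
  rw [starLabelled, List.map_cons, List.map_cons, List.nodup_cons, List.nodup_cons]
  refine ⟨?_, ?_, h⟩ <;> rcases cutLabel_eq p c with h | h <;> simp [h]

namespace ParStepF

variable {p q : Net} {F : Finset (List Tree × List Tree)} {J : Tree → Tree}

/-- A switching of the reduct extends to the net, with prescribed values on the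
    eliminated cuts. -/
theorem exists_switching (h : ParStepF p q F [] []) (hp : p.IsMLL) (hJ : q.IsSwitching J)
    {σ : List Tree × List Tree → Tree} (hσ : ∀ c ∈ F, σ c ∈ c.2) :
    ∃ I, p.IsSwitching I ∧ (∀ c ∈ F, I (Tree.parr c.2) = σ c) ∧ ∀ t ∈ q.ST, I t = J t := by
  have hex : ∀ t, ∃ u, (∀ c ∈ F, t = Tree.parr c.2 → u = σ c) ∧ (t ∈ q.ST → u = J t) ∧
      ∀ ts, t = Tree.parr ts → t ∈ p.ST → u ∈ ts := by
    intro t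
    by_cases h1 : ∃ c ∈ F, t = Tree.parr c.2
    · obtain ⟨c, hc, rfl⟩ := h1
      refine ⟨σ c, fun d hd hcd => ?_, fun hq => absurd hq (h.not_mem_ST hp hc (Or.inr rfl)),
        fun ts hts _ => ?_⟩
      · rw [h.parr_injective hp hc hd (Tree.parr.inj hcd)]
      · rw [← Tree.parr.inj hts]
        exact hσ c hc
    · by_cases h2 : t ∈ q.ST
      · refine ⟨J t, fun c hc htc => absurd ⟨c, hc, htc⟩ h1, fun _ => rfl, ?_⟩
        rintro ts rfl -
        exact hJ ts h2
      · by_cases h3 : ∃ ts, t = Tree.parr ts ∧ t ∈ p.ST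
        · obtain ⟨ts, rfl, hts⟩ := h3
          refine ⟨ts.headI, fun c hc htc => absurd ⟨c, hc, htc⟩ h1, fun h => absurd h h2, ?_⟩
          intro ts' hts' _
          rw [← Tree.parr.inj hts']
          exact headI_mem (hp.2.2.1 ts hts)
        · exact ⟨t, fun c hc htc => absurd ⟨c, hc, htc⟩ h1, fun h => absurd h h2,
            fun ts hts htp => absurd ⟨ts, hts, htp⟩ h3⟩
  choose I hI1 hI2 hI3 using hex
  exact ⟨I, fun ts hts => hI3 _ ts rfl hts, fun c hc => hI1 _ c hc rfl, hI2⟩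

theorem adj_cutLabel (h : ParStepF p q F [] []) {c : List Tree × List Tree} (hc : c ∈ F)
    (I : Tree → Tree) : p.Adj I (cutLabel p c) (Tree.tens c.1) (Tree.parr c.2) := by
  rw [cutLabel]
  split_ifs with hcut
  · exact .cut hcut
  · exact .symm (.cut ((h.hF c hc).2.2.resolve_left hcut))

/-- The edges of the reduct that are not residuals are edges of the net. -/
theorem adj_of_adj (h : ParStepF p q F [] []) {I : Tree → Tree} (hI : ∀ t ∈ q.ST, I t = J t)
    {e : Edge} {u v : Tree} (hadj : q.Adj J e u v) (he : ∀ c ∈ F, e ∉ resEdges c) :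
    p.Adj I e (p.ends J e).1 (p.ends J e).2 := by
  induction hadj with
  | ax n h1 h2 => exact .ax n (h.ST_subset h1) (h.ST_subset h2)
  | tens h1 h2 => exact .tens (h.ST_subset h1) h2
  | parr h1 =>
    have := Net.Adj.parr (I := I) (h.ST_subset h1)
    rwa [hI _ h1] at this
  | jump h1 => exact .jump (h.ST_subset h1)
  | cut h1 =>
    refine .cut ((h.mem_cuts.1 h1).elim And.left ?_)
    rintro ⟨c, hc, hts⟩
    exact absurd (mem_resEdges.2 ⟨_, _, hts, rfl⟩) (he c hc)
  | symm _ ih => exact ih he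

theorem disjoint_starLabelled (h : ParStepF p q F [] []) (hp : p.IsMLL)
    {c d : List Tree × List Tree} (hc : c ∈ F) (hd : d ∈ F) (hcd : c ≠ d) (s s' : Tree) :
    List.Disjoint ((starLabelled p c s).map Prod.fst) ((starLabelled p d s').map Prod.fst) := by
  intro e he he'
  rw [mem_map_fst_starLabelled] at he he'
  have ht : c.1 ≠ d.1 := fun h' => hcd (h.tens_injective hp hc hd h')
  have hs : c.2 ≠ d.2 := fun h' => hcd (h.parr_injective hp hc hd h')
  rcases cutLabel_eq p c with h1 | h1 <;> rcases cutLabel_eq p d with h2 | h2 <;>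
    rw [h1] at he <;> rw [h2] at he' <;> rcases he with rfl | rfl | ⟨t, -, rfl⟩ <;>
    simp [ht, hs, ht.symm] at he'

theorem not_mem_starLabelled (h : ParStepF p q F [] []) (hp : p.IsMLL)
    {c : List Tree × List Tree} (hc : c ∈ F) {s : Tree} {e : Edge} {u v : Tree}
    (hadj : q.Adj J e u v) : e ∉ (starLabelled p c s).map Prod.fst := by
  have ht := h.not_mem_ST hp hc (Or.inl rfl)
  have hs := h.not_mem_ST hp hc (Or.inr rfl)
  rw [mem_map_fst_starLabelled]
  induction hadj with
  | ax n h1 h2 => rcases cutLabel_eq p c with h' | h' <;> simp [h']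
  | tens h1 h2 =>
    rcases cutLabel_eq p c with h' | h' <;> simp [h'] <;>
      (intro _ heq; exact absurd (heq ▸ h1) ht)
  | parr h1 =>
    rcases cutLabel_eq p c with h' | h' <;> simp [h'] <;> (rintro heq; exact hs (heq ▸ h1))
  | jump h1 => rcases cutLabel_eq p c with h' | h' <;> simp [h']
  | cut h1 =>
    rcases cutLabel_eq p c with h' | h' <;> simp [h']
    · rintro rfl; exact absurd (Net.left_mem_ST h1) ht
    · rintro rfl; exact absurd (Net.left_mem_ST h1) hs
  | symm _ ih => exact ih

theorem forest_star (h : ParStepF p q F [] []) (hp : p.IsMLL) (hpa : p.IsAcyclic)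
    (hJ : q.IsSwitching J) {l : List Edge} (hl : l.Nodup)
    (hadj : ∀ e ∈ l, ∃ u v, q.Adj J e u v) {σ : List Tree × List Tree → Tree}
    (hσ : ∀ c ∈ F, σ c ∈ c.2) :
    Forest (F.toList.flatMap (fun c => starEdges c (σ c)) ++
      (keptEdges p F J l).map Prod.snd) := by
  obtain ⟨I, hI, hIσ, hIJ⟩ := h.exists_switching hp hJ hσ
  have hfor := Net.IsAcyclic.forest hp hpa hI
    (F.toList.flatMap (fun c => starLabelled p c (σ c)) ++ keptEdges p F J l) ?_ ?_
  · rw [List.map_append, List.map_flatMap] at hfor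
    simpa only [map_snd_starLabelled] using hfor
  · have hkept : (keptEdges p F J l).map Prod.fst =
        l.filter fun e => ∀ c ∈ F, e ∉ resEdges c := by
      rw [keptEdges, List.map_map]
      exact List.map_id _
    rw [List.map_append, List.map_flatMap, hkept, List.nodup_append']
    refine ⟨List.nodup_flatMap.2 ⟨fun c hc => ?_, ?_⟩, hl.filter _, fun e he he' => ?_⟩
    · exact nodup_map_fst_starLabelled p (h.cutShape hp (Finset.mem_toList.1 hc)).nodup _
    · refine F.nodup_toList.imp_of_mem fun hc hd hcd => ?_
      exact h.disjoint_starLabelled hp (Finset.mem_toList.1 hc) (Finset.mem_toList.1 hd) hcd _ _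
    · obtain ⟨c, hc, he⟩ := List.mem_flatMap.1 he
      obtain ⟨u, v, huv⟩ := hadj e (List.mem_of_mem_filter he')
      exact h.not_mem_starLabelled hp (Finset.mem_toList.1 hc) huv he
  · intro x hx
    rcases List.mem_append.1 hx with hx | hx
    · obtain ⟨c, hc, hx⟩ := List.mem_flatMap.1 hx
      rw [Finset.mem_toList] at hc
      rw [starLabelled, List.mem_cons, List.mem_cons, List.mem_map] at hx
      rcases hx with rfl | rfl | ⟨t, ht, rfl⟩
      · exact h.adj_cutLabel hc I
      · have := Net.Adj.parr (I := I) (h.parr_mem_ST hc)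
        rwa [hIσ c hc] at this
      · exact .tens (h.tens_mem_ST hc) ht
    · obtain ⟨e, he, rfl⟩ := List.mem_map.1 hx
      obtain ⟨he, hres⟩ := List.mem_filter.1 he
      obtain ⟨u, v, huv⟩ := hadj e he
      exact h.adj_of_adj hIJ huv (by simpa using hres)

theorem forest_elim (h : ParStepF p q F [] []) (hp : p.IsMLL) (hpa : p.IsAcyclic)
    (hJ : q.IsSwitching J) {l : List Edge} (hl : l.Nodup)
    (hadj : ∀ e ∈ l, ∃ u v, q.Adj J e u v) {L L' : List (List Tree × List Tree)}
    (hL : F.toList.Perm (L ++ L')) {σ : List Tree × List Tree → Tree} (hσ : ∀ c ∈ L, σ c ∈ c.2) :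
    Forest (L.flatMap (fun c => starEdges c (σ c)) ++ (L'.flatMap elimEdges ++
      (keptEdges p F J l).map Prod.snd)) := by
  have hnd : (L ++ L').Nodup := hL.nodup_iff.1 F.nodup_toList
  have hmem : ∀ c, c ∈ F ↔ c ∈ L ∨ c ∈ L' := fun c => by
    rw [← Finset.mem_toList, hL.mem_iff, List.mem_append]
  rw [List.nodup_append'] at hnd
  refine (Forest.elim_list L' hnd.2.1 (fun c hc => h.cutShape hp ((hmem c).2 (Or.inr hc)))
    fun τ hτ => ?_).of_perm (perm_append_append _ _ _)
  have hfor := h.forest_star hp hpa hJ hl hadj (σ := fun c => if c ∈ L then σ c else τ c)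
    fun c hc => by
      split_ifs with hcL
      · exact hσ c hcL
      · exact hτ c (((hmem c).1 hc).resolve_left hcL)
  have e1 : L.flatMap (fun c => starEdges c (if c ∈ L then σ c else τ c)) =
      L.flatMap fun c => starEdges c (σ c) :=
    List.flatMap_congr fun c hc => by rw [if_pos hc]
  have e2 : L'.flatMap (fun c => starEdges c (if c ∈ L then σ c else τ c)) =
      L'.flatMap fun c => starEdges c (τ c) :=
    List.flatMap_congr fun c hc => by rw [if_neg fun hcL => hnd.2.2 hcL hc]
  refine hfor.of_perm ?_
  refine ((hL.flatMap_right _).append_right _).trans ?_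
  rw [List.flatMap_append, e1, e2, List.append_assoc]
  exact perm_append_append _ _ _

/-- The edges of the reduct are accounted for by residuals, identifications of the trees
    of eliminated cuts with their first premises, and edges of the net. -/
theorem conn_of_adj (h : ParStepF p q F [] []) {G : List (Tree × Tree)}
    (hG : ∀ c ∈ F, headEdges c ⊆ G) {e : Edge} {u v : Tree} (hadj : q.Adj J e u v)
    (hres : ∀ c ∈ F, ∀ t s, (t, s) ∈ c.1.zip c.2 → e = Edge.cutE t s → Conn G t s)
    (hkept : (∀ c ∈ F, e ∉ resEdges c) → p.ends J e ∈ G) : Conn G u v := by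
  induction hadj with
  | ax n h1 h2 => exact Conn.of_mem (hkept fun c _ => by simp [mem_resEdges])
  | tens h1 h2 => exact Conn.of_mem (hkept fun c _ => by simp [mem_resEdges])
  | parr h1 => exact Conn.of_mem (hkept fun c _ => by simp [mem_resEdges])
  | @jump m h1 =>
    have hm : Conn G (Tree.counit m) (p.jump m) :=
      Conn.of_mem (hkept fun c _ => by simp [mem_resEdges])
    refine hm.trans ?_
    rcases h.hjump m h1 with ⟨c, hc, h2, h3⟩ | ⟨c, hc, h2, h3⟩ | ⟨i, hi, -⟩ | ⟨i, hi, -⟩ |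
      ⟨-, -, -, h2⟩
    · rw [h2, h3]
      exact Conn.of_mem (hG c hc (by simp [headEdges, Tree.substList]))
    · rw [h2, h3]
      exact Conn.of_mem (hG c hc (by simp [headEdges, Tree.substList]))
    · simp at hi
    · simp at hi
    · rw [h2]
      exact Conn.refl _
  | @cut t s h1 =>
    by_cases hr : ∀ c ∈ F, Edge.cutE t s ∉ resEdges c
    · exact Conn.of_mem (hkept hr)
    · push Not at hr
      obtain ⟨c, hc, hr⟩ := hr
      obtain ⟨t', s', hts, heq⟩ := mem_resEdges.1 hr
      cases heq
      exact hres c hc t s hts rfl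
  | symm _ ih => exact (ih hres hkept).symm

end ParStepF

theorem CutShape.left_ne {c : List Tree × List Tree} (hc : CutShape c) {t s t' s' : Tree}
    (h : (t, s) ∈ c.1.zip c.2) (h' : (t', s') ∈ c.1.zip c.2)
    (hne : Edge.cutE t s ≠ Edge.cutE t' s') : t ≠ t' := by
  rintro rfl
  exact hne (by rw [zip_snd_eq_of_nodup hc.nodup h h'])

theorem Net.Adj.sameEnds {p : Net} {I : Tree → Tree} {t s u v : Tree}
    (h : p.Adj I (Edge.cutE t s) u v) : SameEnds t s u v := by
  rcases h.ends_eq with h | h <;> cases h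
  · exact Or.inl ⟨rfl, rfl⟩
  · exact Or.inr ⟨rfl, rfl⟩

/-- The subpaths of a trail between four of its edges. -/
theorem Net.IsTrail.exists_conn {q : Net} {J : Tree → Tree} {G : List (Tree × Tree)}
    {d₁ d₂ d₃ d₄ : Edge} {t v₁ v₂ v₃ v₄ : Tree} {l₁ l₂ l₃ : List (Edge × Tree)}
    (h : q.IsTrail J t
      ((d₁, v₁) :: l₁ ++ (d₂, v₂) :: l₂ ++ (d₃, v₃) :: l₃ ++ [(d₄, v₄)]))
    (hG : ∀ e ∈ (l₁ ++ l₂ ++ l₃).map Prod.fst, ∀ u v, q.Adj J e u v → Conn G u v) :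
    ∃ u₁ u₂ u₃ u₄, q.Adj J d₁ u₁ v₁ ∧ q.Adj J d₂ u₂ v₂ ∧ q.Adj J d₃ u₃ v₃ ∧
      q.Adj J d₄ u₄ v₄ ∧ Conn G v₁ u₂ ∧ Conn G v₂ u₃ ∧ Conn G v₃ u₄ := by
  simp only [List.cons_append, List.append_assoc] at h
  simp only [List.map_append, List.mem_append] at hG
  cases h with
  | cons a₁ h _ =>
    obtain ⟨u₂, k₁, h⟩ := h.conn_append fun e he => hG e (Or.inl (Or.inl he))
    cases h with
    | cons a₂ h _ =>
      obtain ⟨u₃, k₂, h⟩ := h.conn_append fun e he => hG e (Or.inl (Or.inr he))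
      cases h with
      | cons a₃ h _ =>
        obtain ⟨u₄, k₃, h⟩ := h.conn_append fun e he => hG e (Or.inr he)
        cases h with
        | cons a₄ _ _ => exact ⟨_, _, _, _, a₁, a₂, a₃, a₄, k₁, k₂, k₃⟩

/-- The residuals of `c` other than those of the premises in `l`. -/
noncomputable def otherRes (c : List Tree × List Tree) (l : List Tree) : List (Tree × Tree) :=
  (c.1.zip c.2).filter fun x => x.1 ∉ l

theorem mem_otherRes {c : List Tree × List Tree} {l : List Tree} {x : Tree × Tree} :
    x ∈ otherRes c l ↔ x ∈ c.1.zip c.2 ∧ x.1 ∉ l := by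
  simp [otherRes]

theorem otherRes_spec (c : List Tree × List Tree) {l : List Tree} {t t' : Tree} (ht : t ∈ l)
    (ht' : t' ∈ l) : OtherRes c t t' (otherRes c l) where
  subset _ he := (mem_otherRes.1 he).1
  ne_left _ he h := (mem_otherRes.1 he).2 (h ▸ ht)
  ne_right _ he h := (mem_otherRes.1 he).2 (h ▸ ht')

end MLLNets

namespace MLLNets

/-- Slipknots are well-bracketed: if `p ⇒m q` is a parallel
    multiplicative reduction of acyclic MLL proof nets, there is no path of
    `q` of the form `(d₁)χ₁(d₂)χ₂(d₁')χ₃(d₂')` where, for `i = 1, 2`, `dᵢ`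
    and `dᵢ'` are residual cut edges of the same eliminated cut of `p`. -/
theorem slipknots_well_bracketed (p q : Net) (F : Finset (List Tree × List Tree))
    (hp : p.IsMLL) (hq : q.IsMLL) (hpa : p.IsAcyclic) (hqa : q.IsAcyclic)
    (hstep : ParStepF p q F [] [])
    (J : Tree → Tree) (hJ : q.IsSwitching J) :
    ¬ ∃ (c₁ c₂ : List Tree × List Tree) (_ : c₁ ∈ F) (_ : c₂ ∈ F)
        (d₁ d₂ d₁' d₂' : Edge) (_ : d₁ ∈ resEdges c₁) (_ : d₁' ∈ resEdges c₁)
        (_ : d₂ ∈ resEdges c₂) (_ : d₂' ∈ resEdges c₂)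
        (t₀ v₁ v₂ v₃ v₄ : Tree) (l₁ l₂ l₃ : List (Edge × Tree)),
      q.IsTrail J t₀ ((d₁, v₁) :: l₁ ++ (d₂, v₂) :: l₂ ++ (d₁', v₃) :: l₃ ++ [(d₂', v₄)]) := by
  classical
  rintro ⟨c₁, c₂, hc₁, hc₂, _, _, _, _, hd₁, hd₃, hd₂, hd₄, t₀, v₁, v₂, v₃, v₄, l₁, l₂, l₃, htr⟩
  obtain ⟨t₁, s₁, h₁, rfl⟩ := mem_resEdges.1 hd₁
  obtain ⟨t₂, s₂, h₂, rfl⟩ := mem_resEdges.1 hd₂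
  obtain ⟨t₃, s₃, h₃, rfl⟩ := mem_resEdges.1 hd₃
  obtain ⟨t₄, s₄, h₄, rfl⟩ := mem_resEdges.1 hd₄
  have hnd := htr.nodup
  have hadj := htr.exists_adj
  have hsc₁ := hstep.cutShape hp hc₁
  have hsc₂ := hstep.cutShape hp hc₂
  set l := ((Edge.cutE t₁ s₁, v₁) :: l₁ ++ (Edge.cutE t₂ s₂, v₂) :: l₂ ++
    (Edge.cutE t₃ s₃, v₃) :: l₃ ++ [(Edge.cutE t₄ s₄, v₄)]).map Prod.fst with hl
  have hperm : l.Perm (Edge.cutE t₁ s₁ :: Edge.cutE t₂ s₂ :: Edge.cutE t₃ s₃ ::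
      Edge.cutE t₄ s₄ :: (l₁ ++ l₂ ++ l₃).map Prod.fst) := by
    refine List.perm_iff_count.2 fun a => ?_
    simp only [hl, List.map_append, List.map_cons, List.map_nil, List.count_append,
      List.count_cons, List.count_nil]
    omega
  have hnd' := hperm.nodup_iff.1 hnd
  simp only [List.nodup_cons, List.mem_cons, not_or] at hnd'
  obtain ⟨⟨h₁₂, h₁₃, -, hr₁⟩, ⟨h₂₃, h₂₄, hr₂⟩, ⟨-, hr₃⟩, hr₄, -⟩ := hnd'
  have hB : ∀ e ∈ (l₁ ++ l₂ ++ l₃).map Prod.fst, (∀ c ∈ F, e ∉ resEdges c) →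
      p.ends J e ∈ (keptEdges p F J l).map Prod.snd := fun e he hres => by
    simp only [keptEdges, List.map_map]
    refine List.mem_map_of_mem (f := Prod.snd ∘ fun e => (e, p.ends J e))
      (List.mem_filter.2 ⟨hperm.mem_iff.2 (by simp only [List.mem_cons, he, or_true]), ?_⟩)
    simpa using hres
  have hne : ∀ e ∈ (l₁ ++ l₂ ++ l₃).map Prod.fst, ∀ d, d ∉ (l₁ ++ l₂ ++ l₃).map Prod.fst →
      e ≠ d := by
    rintro e he d hd rfl
    exact hd he
  by_cases hcc : c₁ = c₂
  · subst hcc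
    have hL := List.perm_cons_erase (Finset.mem_toList.2 hc₁)
    generalize F.toList.erase c₁ = L at hL
    have hmem : ∀ c ∈ F, c = c₁ ∨ c ∈ L := fun c hc =>
      List.mem_cons.1 (hL.mem_iff.1 (Finset.mem_toList.2 hc))
    have hsep : Sep c₁ (L.flatMap elimEdges ++ (keptEdges p F J l).map Prod.snd) :=
      Sep.of_forest hsc₁ fun s hs => by
        have := hstep.forest_elim hp hpa hJ hnd hadj (L := [c₁]) hL (σ := fun _ => s)
          (by simpa using hs)
        simpa using this
    have hG : ∀ e ∈ (l₁ ++ l₂ ++ l₃).map Prod.fst, ∀ u v, q.Adj J e u v →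
        Conn (otherRes c₁ [t₁, t₂, t₃] ++ headEdges c₁ ++
        (L.flatMap elimEdges ++ (keptEdges p F J l).map Prod.snd)) u v := by
      refine fun e he u v huv => hstep.conn_of_adj (fun c hc x hx => ?_) huv ?_ fun hres => ?_
      · rcases hmem c hc with rfl | hcL
        · simp only [List.mem_append, hx, or_true, true_or]
        · have : x ∈ L.flatMap elimEdges :=
            List.mem_flatMap.2 ⟨c, hcL, List.mem_append_right _ hx⟩
          simp only [List.mem_append, this, or_true, true_or]
      · rintro c hc t s hts rfl
        refine Conn.of_mem ?_
        rcases hmem c hc with rfl | hcL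
        · have : (t, s) ∈ otherRes c [t₁, t₂, t₃] := mem_otherRes.2 ⟨hts, by
            simp only [List.mem_cons, List.not_mem_nil, or_false, not_or]
            exact ⟨hsc₁.left_ne hts h₁ (hne _ he _ hr₁), hsc₁.left_ne hts h₂ (hne _ he _ hr₂),
              hsc₁.left_ne hts h₃ (hne _ he _ hr₃)⟩⟩
          simp only [List.mem_append, this, true_or]
        · have : (t, s) ∈ L.flatMap elimEdges :=
            List.mem_flatMap.2 ⟨c, hcL, List.mem_append_left _ hts⟩
          simp only [List.mem_append, this, or_true, true_or]
      · simp only [List.mem_append, hB e he hres, or_true]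
    obtain ⟨u₁, u₂, u₃, u₄, a₁, a₂, a₃, -, k₁, k₂, -⟩ := htr.exists_conn hG
    exact not_well_bracketed_same hsep hsc₁ h₁ h₂ h₃
      (hsc₁.left_ne h₁ h₂ h₁₂) (hsc₁.left_ne h₂ h₃ h₂₃)
      (otherRes_spec c₁ (by simp) (by simp)) (otherRes_spec c₁ (by simp) (by simp))
      a₁.sameEnds a₂.sameEnds a₃.sameEnds k₁ k₂
  · have hL := (List.perm_cons_erase (Finset.mem_toList.2 hc₁)).trans
      ((List.perm_cons_erase ((List.mem_erase_of_ne (Ne.symm hcc)).2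
        (Finset.mem_toList.2 hc₂))).cons c₁)
    generalize (F.toList.erase c₁).erase c₂ = L at hL
    have hmem : ∀ c ∈ F, c = c₁ ∨ c = c₂ ∨ c ∈ L := fun c hc => by
      simpa using hL.mem_iff.1 (Finset.mem_toList.2 hc)
    have hfor : ∀ s ∈ c₁.2, ∀ s' ∈ c₂.2, Forest (starEdges c₁ s ++ (starEdges c₂ s' ++
        (L.flatMap elimEdges ++ (keptEdges p F J l).map Prod.snd))) := fun s hs s' hs' => by
      have := hstep.forest_elim hp hpa hJ hnd hadj (L := [c₁, c₂]) hL
        (σ := fun c => if c = c₁ then s else s') (by simp [hs, hs', Ne.symm hcc])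
      simpa [Ne.symm hcc] using this
    have hG : ∀ e ∈ (l₁ ++ l₂ ++ l₃).map Prod.fst, ∀ u v, q.Adj J e u v →
        Conn (otherRes c₁ [t₁, t₃] ++ headEdges c₁ ++ (otherRes c₂ [t₂, t₄] ++ headEdges c₂ ++
        (L.flatMap elimEdges ++ (keptEdges p F J l).map Prod.snd))) u v := by
      refine fun e he u v huv => hstep.conn_of_adj (fun c hc x hx => ?_) huv ?_ fun hres => ?_
      · rcases hmem c hc with rfl | rfl | hcL
        · simp only [List.mem_append, hx, or_true, true_or]
        · simp only [List.mem_append, hx, or_true, true_or]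
        · have : x ∈ L.flatMap elimEdges :=
            List.mem_flatMap.2 ⟨c, hcL, List.mem_append_right _ hx⟩
          simp only [List.mem_append, this, or_true, true_or]
      · rintro c hc t s hts rfl
        refine Conn.of_mem ?_
        rcases hmem c hc with rfl | rfl | hcL
        · have : (t, s) ∈ otherRes c [t₁, t₃] := mem_otherRes.2 ⟨hts, by
            simp only [List.mem_cons, List.not_mem_nil, or_false, not_or]
            exact ⟨hsc₁.left_ne hts h₁ (hne _ he _ hr₁), hsc₁.left_ne hts h₃ (hne _ he _ hr₃)⟩⟩
          simp only [List.mem_append, this, true_or]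
        · have : (t, s) ∈ otherRes c [t₂, t₄] := mem_otherRes.2 ⟨hts, by
            simp only [List.mem_cons, List.not_mem_nil, or_false, not_or]
            exact ⟨hsc₂.left_ne hts h₂ (hne _ he _ hr₂), hsc₂.left_ne hts h₄ (hne _ he _ hr₄)⟩⟩
          simp only [List.mem_append, this, true_or, or_true]
        · have : (t, s) ∈ L.flatMap elimEdges :=
            List.mem_flatMap.2 ⟨c, hcL, List.mem_append_left _ hts⟩
          simp only [List.mem_append, this, or_true, true_or]
      · simp only [List.mem_append, hB e he hres, or_true]
    obtain ⟨u₁, u₂, u₃, u₄, a₁, a₂, a₃, a₄, k₁, k₂, k₃⟩ := htr.exists_conn hG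
    exact not_well_bracketed_ne hsc₁ hsc₂ hfor h₁ h₂ h₃ h₄
      (hsc₁.left_ne h₁ h₃ h₁₃) (hsc₂.left_ne h₂ h₄ h₂₄)
      (otherRes_spec c₁ (by simp) (by simp)) (otherRes_spec c₂ (by simp) (by simp))
      a₁.sameEnds a₂.sameEnds a₃.sameEnds a₄.sameEnds k₁ k₂ k₃

end MLLNets
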